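/- arXiv:0811.0454 — 14 statements merged into one kernel-verified Lean document; each statement's English description precedes it below -/
import Mathlib

section
/- Let G be a finite simple graph, σ a linear order on V(G), and C a proper coloring of G with positive-integer colors using χ(G) colors. A subset S of V(G) (pre-colored according to C) is a greedy defining set for (G,σ,C) if and only if S intersects every descent of (G,σ,C). -/
/-- `S` is a greedy defining set for `(G, lt, C)` : the greedy algorithm, processing the
vertices not in `S` in increasing `lt`-order and assigning to each the smallest positive
integer not appearing on any already-colored neighbor (neighbors in `S`, which keep their
`C`-colors, and smaller neighbors), reproduces the coloring `C`.  This is expressed by the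
fixed-point equations that uniquely characterize the greedy outcome. -/
def IsGreedyDS {V : Type*} (G : SimpleGraph V) (lt : V → V → Prop)
    (S : Set V) (C : V → ℕ) : Prop :=
  ∀ v ∉ S, C v = sInf {c : ℕ | 0 < c ∧ ∀ u, G.Adj v u → (u ∈ S ∨ lt u v) → C u ≠ c}

/-- A descent of `(G, lt, C)`: a vertex `v` of some color `j = C v` together with all of
its neighbors of some fixed color `i` with `0 < i < j`, under the condition that all
neighbors of `v` of color `i` come after `v` in the order. -/
def IsDescent {V : Type*} (G : SimpleGraph V) (lt : V → V → Prop)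
    (C : V → ℕ) (D : Set V) : Prop :=
  ∃ v i, 0 < i ∧ i < C v ∧ (∀ u, G.Adj v u → C u = i → lt v u) ∧
    D = insert v {u | G.Adj v u ∧ C u = i}

/-- for a finite graph `G` with linear order on its vertices and a proper
coloring `C` with positive colors using `χ(G)` colors, a set `S` is a greedy defining set
for `(G, σ, C)` iff it intersects every descent. -/
theorem gds_iff_meets_every_descent {V : Type*} [Fintype V] [LinearOrder V]
    (G : SimpleGraph V) (C : V → ℕ)
    (hproper : ∀ u v, G.Adj u v → C u ≠ C v)
    (hcolors : ∀ v, 0 < C v ∧ (C v : ℕ∞) ≤ G.chromaticNumber)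
    (S : Set V) :
    IsGreedyDS G (· < ·) S C ↔
      ∀ D : Set V, IsDescent G (· < ·) C D → (S ∩ D).Nonempty := by
  constructor
  · rintro h D ⟨v, i, hi, hiv, hlt, rfl⟩
    by_cases hv : v ∈ S
    · exact ⟨v, hv, Set.mem_insert _ _⟩
    have h1 := h v hv
    rw [h1] at hiv
    have h2 := Nat.notMem_of_lt_sInf hiv
    simp only [Set.mem_setOf_eq, not_and, not_forall, not_not] at h2
    obtain ⟨u, hu, hor, hc⟩ := h2 hi
    have hvu := hlt u hu hc
    rcases hor with hS | hlt'
    · exact ⟨u, hS, Set.mem_insert_of_mem _ ⟨hu, hc⟩⟩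
    · exact absurd hlt' (lt_asymm hvu)
  · intro h v hv
    have hmem : C v ∈ {c : ℕ | 0 < c ∧ ∀ u, G.Adj v u → (u ∈ S ∨ u < v) → C u ≠ c} :=
      ⟨(hcolors v).1, fun u hu _ => (hproper v u hu).symm⟩
    refine le_antisymm (le_csInf ⟨_, hmem⟩ ?_) (Nat.sInf_le hmem)
    rintro c ⟨hc0, hc⟩
    by_contra hlt
    obtain ⟨u, huS, huD⟩ := h _ ⟨v, c, hc0, not_le.mp hlt, fun u hu huc => by
      rcases lt_trichotomy u v with h1 | h1 | h1
      · exact absurd huc (hc u hu (Or.inr h1))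
      · exact absurd h1 hu.ne'
      · exact h1, rfl⟩
    rcases huD with rfl | ⟨hu, huc⟩
    · exact hv huS
    · exact hc u hu (Or.inl huS) huc
end

section
/- A subset D of cells of an n×n Latin square L is a greedy defining set of L if and only if D intersects every descent of L. -/
/-- An `n × n` Latin square with entries in `{1, …, n}`, presented as a function on
`Fin n × Fin n`: every row and every column contains each of `1, …, n` exactly once. -/
def IsLatin (n : ℕ) (L : Fin n → Fin n → ℕ) : Prop :=
  (∀ i j, L i j ∈ Finset.Icc 1 n) ∧
  (∀ i, Function.Injective (L i)) ∧
  (∀ j, Function.Injective fun i => L i j)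

/-- The cell `q` comes strictly before the cell `p` in the lexicographic (row by row,
left to right) order. -/
def cellEarlier {n : ℕ} (q p : Fin n × Fin n) : Prop :=
  q.1 < p.1 ∨ (q.1 = p.1 ∧ q.2 < p.2)

/-- `D` is a greedy defining set of the Latin square `L`: the greedy filling, which
processes the cells not in `D` in lexicographic order and assigns to each cell the
smallest positive entry not yet appearing among the already-filled cells of its row and
column (cells of `D` being pre-filled with their `L`-values), reproduces `L` exactly.
This is expressed by the fixed-point equations that uniquely characterize the greedy
outcome. -/
def IsLatinGDS {n : ℕ} (L : Fin n → Fin n → ℕ) (D : Set (Fin n × Fin n)) : Prop :=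
  ∀ p : Fin n × Fin n, p ∉ D →
    L p.1 p.2 = sInf {c : ℕ | 0 < c ∧ ∀ q : Fin n × Fin n, q ≠ p →
      (q.1 = p.1 ∨ q.2 = p.2) → (q ∈ D ∨ cellEarlier q p) → L q.1 q.2 ≠ c}

/-- A descent of the Latin square `L`: three cells `(i,j), (r,j), (i,k)` with `i < r`,
`j < k`, `L r j = L i k = x`, `L i j = y` and `x < y`. -/
def IsLatinDescent {n : ℕ} (L : Fin n → Fin n → ℕ) (T : Set (Fin n × Fin n)) : Prop :=
  ∃ i r j k : Fin n, i < r ∧ j < k ∧ L r j = L i k ∧ L i k < L i j ∧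
    T = {(i, j), (r, j), (i, k)}

theorem exists_eq_of_inj_Icc {n : ℕ} (f : Fin n → ℕ) (hf : ∀ i, f i ∈ Finset.Icc 1 n)
    (hi : Function.Injective f) (c : ℕ) (hc : c ∈ Finset.Icc 1 n) : ∃ i, f i = c := by
  have h : Finset.univ.image f = Finset.Icc 1 n := by
    apply Finset.eq_of_subset_of_card_le
    · intro x hx
      obtain ⟨i, -, rfl⟩ := Finset.mem_image.1 hx
      exact hf i
    · rw [Finset.card_image_of_injective _ hi]
      simp
  rw [← h] at hc
  obtain ⟨i, -, hi⟩ := Finset.mem_image.1 hc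
  exact ⟨i, hi⟩

/-- a subset `D` of cells of an `n × n` Latin square `L` is a greedy
defining set of `L` iff `D` intersects every descent of `L`. -/
theorem latin_gds_iff_meets_every_descent {n : ℕ} (L : Fin n → Fin n → ℕ)
    (hL : IsLatin n L) (D : Set (Fin n × Fin n)) :
    IsLatinGDS L D ↔
      ∀ T : Set (Fin n × Fin n), IsLatinDescent L T → (D ∩ T).Nonempty := by
  obtain ⟨hR, hrow, hcol⟩ := hL
  constructor
  · rintro h T ⟨i, r, j, k, hir, hjk, hx, hlt, rfl⟩
    by_contra hne
    rw [Set.not_nonempty_iff_eq_empty] at hne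
    have hD : ∀ q ∈ ({(i, j), (r, j), (i, k)} : Set (Fin n × Fin n)), q ∉ D := by
      intro q hq hqD
      have : q ∈ D ∩ {(i, j), (r, j), (i, k)} := ⟨hqD, hq⟩
      rw [hne] at this
      exact this
    have h1 := hD (i, j) (by simp)
    have h2 := hD (r, j) (by simp)
    have h3 := hD (i, k) (by simp)
    have h4 := h (i, j) h1
    simp only at h4
    have h5 := hlt
    rw [h4] at h5
    have h6 := Nat.notMem_of_lt_sInf h5
    apply h6
    refine ⟨(Finset.mem_Icc.1 (hR i k)).1, ?_⟩
    rintro ⟨a, b⟩ hq hor hDe heq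
    simp only at hor heq
    rcases hor with rfl | rfl
    · obtain rfl := hrow _ heq
      rcases hDe with hd | hd | hd
      · exact h3 hd
      · exact lt_irrefl _ hd
      · exact lt_asymm hjk hd.2
    · have : a = r := hcol b (heq.trans hx.symm)
      subst this
      rcases hDe with hd | hd | hd
      · exact h2 hd
      · exact lt_asymm hir hd
      · exact hir.ne' hd.1
  · rintro h ⟨i, j⟩ hp
    have hmem : L i j ∈ {c : ℕ | 0 < c ∧ ∀ q : Fin n × Fin n, q ≠ (i, j) →
        (q.1 = i ∨ q.2 = j) → (q ∈ D ∨ cellEarlier q (i, j)) → L q.1 q.2 ≠ c} := by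
      refine ⟨(Finset.mem_Icc.1 (hR i j)).1, ?_⟩
      rintro ⟨a, b⟩ hq hor - heq
      simp only at hor heq
      rcases hor with rfl | rfl
      · exact hq (by rw [hrow _ heq])
      · have : a = i := hcol b heq
        exact hq (by rw [this])
    apply le_antisymm _ (Nat.sInf_le hmem)
    apply le_csInf ⟨_, hmem⟩
    rintro c ⟨hc0, hc⟩
    by_contra hlt
    simp only [not_le] at hlt
    have hcI : c ∈ Finset.Icc 1 n :=
      Finset.mem_Icc.2 ⟨hc0, hlt.le.trans (Finset.mem_Icc.1 (hR i j)).2⟩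
    obtain ⟨k, hk⟩ := exists_eq_of_inj_Icc (L i) (hR i) (hrow i) c hcI
    obtain ⟨r, hr⟩ := exists_eq_of_inj_Icc (fun i => L i j) (fun i => hR i j) (hcol j) c hcI
    have hkj : k ≠ j := by rintro rfl; omega
    have hri : r ≠ i := by rintro rfl; omega
    have hk' : ¬ ((i, k) ∈ D ∨ cellEarlier (i, k) (i, j)) := fun hh =>
      hc (i, k) (by simpa using hkj) (Or.inl rfl) hh hk
    have hr' : ¬ ((r, j) ∈ D ∨ cellEarlier (r, j) (i, j)) := fun hh =>
      hc (r, j) (by simpa using hri) (Or.inr rfl) hh hr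
    have hjk : j < k := lt_of_le_of_ne
      (not_lt.1 fun hh => hk' (Or.inr (Or.inr ⟨rfl, hh⟩))) hkj.symm
    have hir : i < r := lt_of_le_of_ne
      (not_lt.1 fun hh => hr' (Or.inr (Or.inl hh))) hri.symm
    obtain ⟨q, hqD, hq⟩ := h _ ⟨i, r, j, k, hir, hjk, hr.trans hk.symm, by omega, rfl⟩
    rcases hq with rfl | rfl | rfl
    · exact hp hqD
    · exact hr' (Or.inl hqD)
    · exact hk' (Or.inl hqD)
end

section
/- Let G be a finite connected bipartite graph with at least one edge, with bipartition (X,Y), let σ be any linear order on V(G), and let C be the proper 2-coloring of G assigning color 1 to X and color 2 to Y. Then there exists a greedy defining set S for (G,σ,C) of minimum cardinality (|S| = GDN(G,σ,C)) such that every vertex of S has color 1, i.e., S ⊆ X. -/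
/-- `GDN(G, lt, C)` : the minimum cardinality of a greedy defining set for `(G, lt, C)`. -/
noncomputable def gdnColored {V : Type*} (G : SimpleGraph V) (lt : V → V → Prop)
    (C : V → ℕ) : ℕ :=
  sInf {k : ℕ | ∃ S : Set V, IsGreedyDS G lt S C ∧ S.ncard = k}

theorem gds_iff_aux {V : Type*} [LinearOrder V]
    (G : SimpleGraph V) (X Y : Set V) (hdisj : Disjoint X Y)
    (hbip : ∀ u v, G.Adj u v → (u ∈ X ∧ v ∈ Y) ∨ (u ∈ Y ∧ v ∈ X))
    (C : V → ℕ) (hC1 : ∀ v ∈ X, C v = 1) (hC2 : ∀ v ∉ X, C v = 2) (S : Set V) :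
    IsGreedyDS G (· < ·) S C ↔
      ∀ v ∉ S, v ∉ X → ∃ u, G.Adj v u ∧ (u ∈ S ∨ u < v) := by
  have hXY : ∀ a, a ∈ X → a ∈ Y → False := fun a h1 h2 => Set.disjoint_left.1 hdisj h1 h2
  unfold IsGreedyDS
  constructor
  · intro h v hv hvX
    by_contra hcon
    push Not at hcon
    have h1 := h v hv
    rw [hC2 v hvX] at h1
    have : sInf {c : ℕ | 0 < c ∧ ∀ u, G.Adj v u → (u ∈ S ∨ u < v) → C u ≠ c} ≤ 1 := by
      apply Nat.sInf_le
      refine ⟨one_pos, fun u hu hu' => ?_⟩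
      have := hcon u hu
      rcases hu' with h | h
      · exact absurd h this.1
      · exact absurd h (not_lt.2 this.2)
    exact absurd (h1.le.trans this) (by decide)
  · intro h v hv
    symm
    by_cases hvX : v ∈ X
    · rw [hC1 v hvX]
      refine IsLeast.csInf_eq ⟨⟨one_pos, fun u hu _ => ?_⟩, fun c hc => hc.1⟩
      have : u ∉ X := by
        rcases hbip v u hu with ⟨_, h2⟩ | ⟨h1, _⟩
        · exact fun h => hXY u h h2
        · exact (hXY v hvX h1).elim
      rw [hC2 u this]; decide
    · rw [hC2 v hvX]
      have key : ∀ u, G.Adj v u → C u = 1 := by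
        intro u hu
        rcases hbip v u hu with ⟨h1, _⟩ | ⟨_, h2⟩
        · exact absurd h1 hvX
        · exact hC1 u h2
      refine IsLeast.csInf_eq ⟨⟨two_pos, fun u hu _ => ?_⟩, fun c hc => ?_⟩
      · rw [key u hu]; decide
      · obtain ⟨u, hu, hu'⟩ := h v hv hvX
        have h1 := hc.2 u hu hu'
        rw [key u hu] at h1
        have := hc.1
        omega

/-- for a finite connected bipartite graph `G` with at least one edge, with
bipartition `(X, Y)`, any linear order on the vertices, and the proper `2`-coloring `C`
giving color `1` to `X` and color `2` to `Y`, there is a minimum greedy defining set for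
`(G, σ, C)` consisting only of vertices of color `1`, i.e. contained in `X`. -/
theorem exists_min_gds_in_first_color_class {V : Type*} [Fintype V] [LinearOrder V]
    (G : SimpleGraph V) (X Y : Set V)
    (hcover : ∀ v, v ∈ X ∪ Y) (hdisj : Disjoint X Y)
    (hbip : ∀ u v, G.Adj u v → (u ∈ X ∧ v ∈ Y) ∨ (u ∈ Y ∧ v ∈ X))
    (hconn : G.Connected) (hedge : ∃ u v, G.Adj u v)
    (C : V → ℕ) (hC1 : ∀ v ∈ X, C v = 1) (hC2 : ∀ v ∉ X, C v = 2) :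
    ∃ S : Set V, IsGreedyDS G (· < ·) S C ∧
      S.ncard = gdnColored G (· < ·) C ∧ S ⊆ X := by
  have iff := gds_iff_aux G X Y hdisj hbip C hC1 hC2
  have hne : {k : ℕ | ∃ S : Set V, IsGreedyDS G (· < ·) S C ∧ S.ncard = k}.Nonempty :=
    ⟨_, Set.univ, (iff _).2 (fun v hv => absurd (Set.mem_univ v) hv), rfl⟩
  obtain ⟨S, hS, hcard⟩ := Nat.sInf_mem hne
  have hnb : ∀ v, ∃ u, G.Adj v u := by
    obtain ⟨a, b, hab⟩ := hedge
    haveI : Nontrivial V := ⟨a, b, hab.ne⟩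
    exact fun v => hconn.preconnected.exists_adj_of_nontrivial v
  choose g hg using hnb
  classical
  let f : V → V := fun v => if v ∈ X then v else g v
  have hfX : ∀ v, v ∈ X → f v = v := fun v hv => if_pos hv
  have hfY : ∀ v, v ∉ X → f v = g v := fun v hv => if_neg hv
  have hnX : ∀ v u, v ∉ X → G.Adj v u → u ∈ X := by
    intro v u hv hu
    rcases hbip v u hu with ⟨h1, _⟩ | ⟨_, h2⟩
    · exact absurd h1 hv
    · exact h2
  have hS' : IsGreedyDS G (· < ·) (f '' S) C := by
    rw [iff] at hS ⊢
    intro v _ hvX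
    by_cases hvS : v ∈ S
    · exact ⟨g v, hg v, Or.inl ⟨v, hvS, hfY v hvX⟩⟩
    · obtain ⟨u, hu, hu'⟩ := hS v hvS hvX
      exact ⟨u, hu, hu'.imp_left fun h => ⟨u, h, hfX u (hnX v u hvX hu)⟩⟩
  refine ⟨f '' S, hS', le_antisymm ?_ (Nat.sInf_le ⟨_, hS', rfl⟩), ?_⟩
  · exact (Set.ncard_image_le S.toFinite).trans hcard.le
  · rintro _ ⟨v, _, rfl⟩
    by_cases hv : v ∈ X
    · rw [hfX v hv]; exact hv
    · rw [hfY v hv]; exact hnX v _ hv (hg v)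
end

section
/- Let F be a finite connected simple graph with at least one edge. Let V₁, V₂ be two disjoint copies of V(F) and E₁, E₂ two disjoint copies of E(F). Let G be the bipartite graph with parts X = V₁ ∪ E₁ and Y = V₂ ∪ E₂ and edges: v ∈ V₁ adjacent to e ∈ E₂ iff e is incident to v in F; v ∈ V₂ adjacent to e ∈ E₁ iff e is incident to v in F; and each v ∈ V₁ adjacent to its copy v′ ∈ V₂. Let σ be any linear order on V(G) in which every element of E₂ precedes every element of E₁, every element of E₁ precedes every element of V₂, and every element of V₂ precedes every element of V₁. Then GDN(G,σ) equals the minimum size of a vertex cover of F. -/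
/-- `(S, C₀)` is a greedy defining set for `(G, lt)` : `S` is pre-colored with positive
colors by `C₀`, and the greedy algorithm, processing the vertices not in `S` in increasing
`lt`-order and assigning to each the smallest positive integer not appearing on any
already-colored neighbor, produces a proper coloring `f` of `G` using `χ(G)` colors. -/
def IsUGDS {V : Type*} (G : SimpleGraph V) (lt : V → V → Prop)
    (S : Set V) (C₀ : V → ℕ) : Prop :=
  (∀ v ∈ S, 0 < C₀ v) ∧
  ∃ f : V → ℕ,
    (∀ v ∈ S, f v = C₀ v) ∧
    (∀ v ∉ S, f v =
      sInf {c : ℕ | 0 < c ∧ ∀ u, G.Adj v u → (u ∈ S ∨ lt u v) → f u ≠ c}) ∧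
    (∀ u v, G.Adj u v → f u ≠ f v) ∧
    (∀ v, (f v : ℕ∞) ≤ G.chromaticNumber)

/-- `GDN(G, lt)` : the minimum cardinality of a greedy defining set for `(G, lt)`. -/
noncomputable def gdn {V : Type*} (G : SimpleGraph V) (lt : V → V → Prop) : ℕ :=
  sInf {k : ℕ | ∃ (S : Set V) (C₀ : V → ℕ), IsUGDS G lt S C₀ ∧ S.ncard = k}

/-- The minimum size of a vertex cover of `F`. -/
noncomputable def minVertexCover {α : Type*} (F : SimpleGraph α) : ℕ :=
  sInf {k : ℕ | ∃ K : Set α, (∀ u v, F.Adj u v → u ∈ K ∨ v ∈ K) ∧ K.ncard = k}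

/-- The vertex set of the reduction graph: the part `X = V₁ ∪ E₁` is the left summand
(`V₁ = Sum.inl ∘ Sum.inl`, `E₁ = Sum.inl ∘ Sum.inr`) and the part `Y = V₂ ∪ E₂` is the
right summand (`V₂ = Sum.inr ∘ Sum.inl`, `E₂ = Sum.inr ∘ Sum.inr`). -/
abbrev RedVertex {α : Type*} (F : SimpleGraph α) : Type _ :=
  (α ⊕ ↥F.edgeSet) ⊕ (α ⊕ ↥F.edgeSet)

/-- The defining relation of the reduction graph: `v ∈ V₁` is adjacent to `e ∈ E₂` iff
`e` is incident to `v` in `F`; `v ∈ V₂` is adjacent to `e ∈ E₁` iff `e` is incident to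
`v` in `F`; and each `v ∈ V₁` is adjacent to its copy in `V₂`. -/
def redRel {α : Type*} (F : SimpleGraph α) : RedVertex F → RedVertex F → Prop
  | Sum.inl (Sum.inl v), Sum.inr (Sum.inr e) => v ∈ (e : Sym2 α)
  | Sum.inr (Sum.inl v), Sum.inl (Sum.inr e) => v ∈ (e : Sym2 α)
  | Sum.inl (Sum.inl v), Sum.inr (Sum.inl w) => v = w
  | _, _ => False

/-- The block of a vertex of the reduction graph: `E₂` first, then `E₁`, then `V₂`,
then `V₁`. -/
def blockIdx {α : Type*} (F : SimpleGraph α) : RedVertex F → ℕ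
  | Sum.inr (Sum.inr _) => 0
  | Sum.inl (Sum.inr _) => 1
  | Sum.inr (Sum.inl _) => 2
  | Sum.inl (Sum.inl _) => 3

theorem red_colorable {α : Type*} (F : SimpleGraph α) :
    (SimpleGraph.fromRel (redRel F)).chromaticNumber ≤ 2 := by
  have : (SimpleGraph.fromRel (redRel F)).Colorable 2 := by
    refine ⟨SimpleGraph.Coloring.mk (fun x => match x with
      | Sum.inl _ => (0 : Fin 2)
      | Sum.inr _ => 1) ?_⟩
    rintro ((a | a) | (a | a)) ((b | b) | (b | b)) h <;>
      simp_all [SimpleGraph.fromRel_adj, redRel]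
  exact_mod_cast this.chromaticNumber_le

theorem red_upper {α : Type*} [Fintype α] (F : SimpleGraph α)
    (hconn : F.Connected) (hedge : ∃ u v, F.Adj u v)
    (lt : RedVertex F → RedVertex F → Prop)
    (hirr : ∀ x, ¬ lt x x)
    (htrans : ∀ x y z, lt x y → lt y z → lt x z)
    (hblock : ∀ x y, blockIdx F x < blockIdx F y → lt x y)
    (K : Set α) (hK : ∀ u v, F.Adj u v → u ∈ K ∨ v ∈ K) :
    ∃ (S : Set (RedVertex F)) (C₀ : RedVertex F → ℕ),
      IsUGDS (SimpleGraph.fromRel (redRel F)) lt S C₀ ∧ S.ncard = K.ncard := by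
  have hnt : Nontrivial α := by
    obtain ⟨u, v, h⟩ := hedge
    exact ⟨u, v, h.ne⟩
  have hinc : ∀ v, ∃ w, F.Adj v w := fun v => by
    classical
    exact hconn.preconnected.exists_adj_of_nontrivial v
  have h2 : 2 ≤ (SimpleGraph.fromRel (redRel F)).chromaticNumber := by
    obtain ⟨u, _⟩ := hedge
    refine SimpleGraph.two_le_chromaticNumber_of_adj
      (u := Sum.inl (Sum.inl u)) (v := Sum.inr (Sum.inl u)) ?_
    simp [SimpleGraph.fromRel_adj, redRel]
  refine ⟨(fun v => Sum.inl (Sum.inl v)) '' K, fun _ => 1, ⟨by simp, ?_⟩, ?_⟩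
  · let f : RedVertex F → ℕ := fun x => match x with
      | Sum.inl _ => 1
      | Sum.inr _ => 2
    have key1 : ∀ (P : ℕ → Prop), P 1 → (1 : ℕ) = sInf {c : ℕ | 0 < c ∧ P c} := by
      intro P h
      refine le_antisymm ?_ (Nat.sInf_le ⟨one_pos, h⟩)
      exact (Nat.sInf_mem (s := {c : ℕ | 0 < c ∧ P c}) ⟨1, one_pos, h⟩).1
    have key2 : ∀ (P : ℕ → Prop), ¬ P 1 → P 2 → (2 : ℕ) = sInf {c : ℕ | 0 < c ∧ P c} := by
      intro P h h'
      refine le_antisymm ?_ (Nat.sInf_le ⟨two_pos, h'⟩)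
      have := (Nat.sInf_mem (s := {c : ℕ | 0 < c ∧ P c}) ⟨2, two_pos, h'⟩)
      by_contra hlt
      have h1 : sInf {c : ℕ | 0 < c ∧ P c} = 1 := by have := this.1; omega
      rw [h1] at this
      exact h this.2
    have hside : ∀ a b, (SimpleGraph.fromRel (redRel F)).Adj a b → f a + f b = 3 := by
      rintro ((a | a) | (a | a)) ((b | b) | (b | b)) h <;>
        first
        | rfl
        | (exfalso; simp [SimpleGraph.fromRel_adj, redRel] at h)
    refine ⟨f, ?_, ?_, ?_, ?_⟩
    · rintro _ ⟨v, _, rfl⟩; rfl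
    · rintro ((v | e) | (v | e)) hv
      · apply key1
        intro b h _
        have h3 := hside _ _ h
        have h4 : f (Sum.inl (Sum.inl v)) = 1 := rfl
        omega
      · apply key1
        intro b h _
        have h3 := hside _ _ h
        have h4 : f (Sum.inl (Sum.inr e)) = 1 := rfl
        omega
      · apply key2
        · intro h
          obtain ⟨w, hw⟩ := hinc v
          refine h (Sum.inl (Sum.inr ⟨s(v, w), hw⟩)) ?_ (Or.inr ?_) rfl
          · simp [SimpleGraph.fromRel_adj, redRel]
          · apply hblock; simp [blockIdx]
        · intro b h _
          have h3 := hside _ _ h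
          have h4 : f (Sum.inr (Sum.inl v)) = 2 := rfl
          omega
      · apply key2
        · intro h
          obtain ⟨e, he⟩ := e
          induction e using Sym2.ind with
          | _ u w =>
            rcases hK u w he with hu | hu
            · exact h (Sum.inl (Sum.inl u)) (by simp [SimpleGraph.fromRel_adj, redRel])
                (Or.inl ⟨u, hu, rfl⟩) rfl
            · exact h (Sum.inl (Sum.inl w)) (by simp [SimpleGraph.fromRel_adj, redRel])
                (Or.inl ⟨w, hu, rfl⟩) rfl
        · intro b h _
          have h3 := hside _ _ h
          have h4 : f (Sum.inr (Sum.inr e)) = 2 := rfl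
          omega
    · intro a b h
      have h3 := hside _ _ h
      omega
    · intro v
      refine le_trans ?_ h2
      rcases v with v | v
      · simp [f]
      · simp [f]
  · exact Set.ncard_image_of_injective _ (fun a b h => by simpa using h)

theorem red_lower {α : Type*} [Fintype α] (F : SimpleGraph α)
    (hconn : F.Connected)
    (lt : RedVertex F → RedVertex F → Prop)
    (hirr : ∀ x, ¬ lt x x)
    (htrans : ∀ x y z, lt x y → lt y z → lt x z)
    (hblock : ∀ x y, blockIdx F x < blockIdx F y → lt x y)
    (S : Set (RedVertex F)) (C₀ : RedVertex F → ℕ)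
    (hS : IsUGDS (SimpleGraph.fromRel (redRel F)) lt S C₀) :
    ∃ K : Set α, (∀ u v, F.Adj u v → u ∈ K ∨ v ∈ K) ∧ K.ncard ≤ S.ncard := by
  obtain ⟨hpos, f, hfS, hf, hprop, hchi⟩ := hS
  have hle : ∀ v, f v ≤ 2 := fun v => by
    have := (hchi v).trans (red_colorable F)
    exact_mod_cast this
  have hfpos : ∀ v, 0 < f v := by
    intro v
    by_cases hv : v ∈ S
    · rw [hfS v hv]; exact hpos v hv
    · rw [hf v hv]
      refine (Nat.sInf_mem (s := {c : ℕ | 0 < c ∧ ∀ u,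
        (SimpleGraph.fromRel (redRel F)).Adj v u → (u ∈ S ∨ lt u v) → f u ≠ c}) ⟨3, ?_⟩).1
      refine ⟨by norm_num, fun u _ _ => ?_⟩
      have := hle u; omega
  have hex : ∀ v, f v = 2 → v ∉ S → ∃ u, (SimpleGraph.fromRel (redRel F)).Adj v u ∧
      (u ∈ S ∨ lt u v) := by
    intro v h2 hv
    by_contra hno
    push Not at hno
    have h1 : f v ≤ 1 := by
      rw [hf v hv]
      refine Nat.sInf_le ⟨one_pos, fun u hu hu' => ?_⟩
      rcases hu' with h | h
      · exact absurd h (hno u hu).1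
      · exact absurd h (hno u hu).2
    omega
  have hflip : ∀ a b, (SimpleGraph.fromRel (redRel F)).Adj a b → f a + f b = 3 := by
    intro a b h
    have := hprop a b h
    have := hle a; have := hle b; have := hfpos a; have := hfpos b
    omega
  have h12 : ∀ v, f (Sum.inl (Sum.inl v)) + f (Sum.inr (Sum.inl v)) = 3 := fun v =>
    hflip _ _ (by simp [SimpleGraph.fromRel_adj, redRel])
  have h1e : ∀ v (e : F.edgeSet), v ∈ (e : Sym2 α) →
      f (Sum.inl (Sum.inl v)) + f (Sum.inr (Sum.inr e)) = 3 := fun v e h =>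
    hflip _ _ (by simp [SimpleGraph.fromRel_adj, redRel, h])
  have h2e : ∀ v (e : F.edgeSet), v ∈ (e : Sym2 α) →
      f (Sum.inr (Sum.inl v)) + f (Sum.inl (Sum.inr e)) = 3 := fun v e h =>
    hflip _ _ (by simp [SimpleGraph.fromRel_adj, redRel, h])
  have hadj : ∀ v w, F.Adj v w → f (Sum.inl (Sum.inl v)) = f (Sum.inl (Sum.inl w)) := by
    intro v w h
    have a := h1e v ⟨s(v, w), h⟩ (by simp)
    have b := h1e w ⟨s(v, w), h⟩ (by simp)
    omega
  have hconst : ∀ v w, f (Sum.inl (Sum.inl v)) = f (Sum.inl (Sum.inl w)) := by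
    intro v w
    obtain ⟨p⟩ := hconn.preconnected v w
    induction p with
    | nil => rfl
    | cons h _ ih => exact (hadj _ _ h).trans ih
  have hnlt : ∀ x y, blockIdx F x < blockIdx F y → ¬ lt y x := fun x y h h' =>
    hirr _ (htrans _ _ _ h' (hblock _ _ h))
  let g : RedVertex F → α := fun x => match x with
    | Sum.inl (Sum.inl v) => v
    | Sum.inr (Sum.inl v) => v
    | Sum.inl (Sum.inr e) => (Quot.out (e : Sym2 α)).1
    | Sum.inr (Sum.inr e) => (Quot.out (e : Sym2 α)).1
  have hout : ∀ e : Sym2 α, (Quot.out e).1 ∈ e := fun e => Sym2.out_fst_mem e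
  have hSfin : S.Finite := by
    have : Finite (RedVertex F) := inferInstance
    exact Set.toFinite S
  refine ⟨g '' S, ?_, Set.ncard_image_le hSfin⟩
  intro u v huv
  suffices h : ∃ x ∈ S, g x ∈ s(u, v) by
    obtain ⟨x, hx, hxg⟩ := h
    rcases Sym2.mem_iff.1 hxg with h | h
    · exact Or.inl ⟨x, hx, h⟩
    · exact Or.inr ⟨x, hx, h⟩
  let e : F.edgeSet := ⟨s(u, v), huv⟩
  have hue : u ∈ (e : Sym2 α) := by simp [e]
  have ha := h12 u
  have hb := h1e u e hue
  have hc := h2e u e hue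
  have hp := hfpos (Sum.inl (Sum.inl u))
  have hq := hle (Sum.inl (Sum.inl u))
  have hcases : f (Sum.inr (Sum.inr e)) = 2 ∨ f (Sum.inl (Sum.inr e)) = 2 := by omega
  rcases hcases with h | h
  · by_cases hm : (Sum.inr (Sum.inr e) : RedVertex F) ∈ S
    · exact ⟨_, hm, hout _⟩
    · obtain ⟨((b | b) | (b | b)), hb1, hb2⟩ := hex _ h hm <;>
        simp [SimpleGraph.fromRel_adj, redRel] at hb1
      have := hnlt (Sum.inr (Sum.inr e)) (Sum.inl (Sum.inl b)) (by simp [blockIdx])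
      exact ⟨_, hb2.resolve_right this, hb1⟩
  · by_cases hm : (Sum.inl (Sum.inr e) : RedVertex F) ∈ S
    · exact ⟨_, hm, hout _⟩
    · obtain ⟨((b | b) | (b | b)), hb1, hb2⟩ := hex _ h hm <;>
        simp [SimpleGraph.fromRel_adj, redRel] at hb1
      have := hnlt (Sum.inl (Sum.inr e)) (Sum.inr (Sum.inl b)) (by simp [blockIdx])
      exact ⟨_, hb2.resolve_right this, hb1⟩

/-- for a finite connected graph `F` with at least one edge, the greedy
defining number of the reduction graph, with respect to any linear order in which
`E₂ < E₁ < V₂ < V₁` blockwise, equals the minimum size of a vertex cover of `F`. -/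
theorem gdn_reduction_eq_minVertexCover {α : Type*} [Fintype α] (F : SimpleGraph α)
    (hconn : F.Connected) (hedge : ∃ u v, F.Adj u v)
    (lt : RedVertex F → RedVertex F → Prop)
    (hirr : ∀ x, ¬ lt x x)
    (htrans : ∀ x y z, lt x y → lt y z → lt x z)
    (htotal : ∀ x y, x ≠ y → lt x y ∨ lt y x)
    (hblock : ∀ x y, blockIdx F x < blockIdx F y → lt x y) :
    gdn (SimpleGraph.fromRel (redRel F)) lt = minVertexCover F := by
  have hcov : {k : ℕ | ∃ K : Set α, (∀ u v, F.Adj u v → u ∈ K ∨ v ∈ K) ∧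
      K.ncard = k}.Nonempty := ⟨_, Set.univ, fun _ _ _ => Or.inl trivial, rfl⟩
  obtain ⟨K, hK, hKc⟩ := Nat.sInf_mem hcov
  obtain ⟨S, C₀, hS, hSc⟩ := red_upper F hconn hedge lt hirr htrans hblock K hK
  apply le_antisymm
  · exact Nat.sInf_le ⟨S, C₀, hS, hSc.trans hKc⟩
  · have hne : {k : ℕ | ∃ (S : Set (RedVertex F)) (C₀ : RedVertex F → ℕ),
        IsUGDS (SimpleGraph.fromRel (redRel F)) lt S C₀ ∧ S.ncard = k}.Nonempty :=
      ⟨_, S, C₀, hS, rfl⟩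
    obtain ⟨S', C', hS', hSc'⟩ := Nat.sInf_mem hne
    obtain ⟨K', hK', hle⟩ := red_lower F hconn lt hirr htrans hblock S' C' hS'
    have h5 : minVertexCover F ≤ K'.ncard := Nat.sInf_le ⟨K', hK', rfl⟩
    exact h5.trans (hle.trans hSc'.le)
end

section
/- Let F be a finite connected simple graph with at least one edge, with copies V₁, V₂ of V(F) and E₁, E₂ of E(F), and let G be the bipartite graph with parts X = V₁ ∪ E₁ and Y = V₂ ∪ E₂ and edges: v ∈ V₁ adjacent to e ∈ E₂ iff e is incident to v in F; v ∈ V₂ adjacent to e ∈ E₁ iff e is incident to v in F; and each v ∈ V₁ adjacent to its copy v′ ∈ V₂. Let σ be any linear order on V(G) with E₂ < E₁ < V₂ < V₁ (blockwise), and let C be the 2-coloring giving color 1 to X and color 2 to Y. Then the descents of (G,σ,C) are exactly the sets {e} ∪ {copies in V₁ of the two endpoints of e} for e ∈ E₂. -/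
theorem redNbr {α : Type*} (F : SimpleGraph α) (e : ↥F.edgeSet) :
    {u : RedVertex F | (SimpleGraph.fromRel (redRel F)).Adj (Sum.inr (Sum.inr e)) u ∧
      (Sum.elim (fun _ => 1) (fun _ => 2) : RedVertex F → ℕ) u = 1} =
      {w | ∃ v ∈ (e : Sym2 α), w = Sum.inl (Sum.inl v)} := by
  ext u
  rcases u with (v | f) | (v | f) <;> simp [SimpleGraph.fromRel_adj, redRel]

/-- in the reduction graph of a finite connected graph `F` with at least one
edge, ordered by any linear order with `E₂ < E₁ < V₂ < V₁` blockwise and `2`-colored with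
color `1` on `X` and color `2` on `Y`, the descents are exactly the sets consisting of an
`e ∈ E₂` together with the `V₁`-copies of the two endpoints of `e`. -/
theorem descents_of_reduction {α : Type*} [Fintype α] (F : SimpleGraph α)
    (hconn : F.Connected) (hedge : ∃ u v, F.Adj u v)
    (lt : RedVertex F → RedVertex F → Prop)
    (hirr : ∀ x, ¬ lt x x)
    (htrans : ∀ x y z, lt x y → lt y z → lt x z)
    (htotal : ∀ x y, x ≠ y → lt x y ∨ lt y x)
    (hblock : ∀ x y, blockIdx F x < blockIdx F y → lt x y) :
    ∀ D : Set (RedVertex F),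
      IsDescent (SimpleGraph.fromRel (redRel F)) lt
          (Sum.elim (fun _ => 1) (fun _ => 2)) D ↔
        ∃ e : ↥F.edgeSet,
          D = insert (Sum.inr (Sum.inr e))
            {w | ∃ v ∈ (e : Sym2 α), w = Sum.inl (Sum.inl v)} := by
  intro D
  constructor
  · rintro ⟨x, i, hi, hlt, hall, rfl⟩
    rcases x with x | (v | e)
    · simp at hlt; omega
    · exfalso
      have hi1 : i = 1 := by simp at hlt; omega
      subst hi1
      obtain ⟨a, b, hab⟩ := hedge
      have : Nontrivial α := ⟨a, b, hab.ne⟩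
      obtain ⟨w, hw⟩ := hconn.preconnected.exists_adj_of_nontrivial v
      have h1 := hall (Sum.inl (Sum.inr ⟨s(v, w), hw⟩))
        (by simp [SimpleGraph.fromRel_adj, redRel]) rfl
      have h2 := hblock (Sum.inl (Sum.inr ⟨s(v, w), hw⟩)) (Sum.inr (Sum.inl v))
        (by simp [blockIdx])
      exact hirr _ (htrans _ _ _ h1 h2)
    · have hi1 : i = 1 := by simp at hlt; omega
      subst hi1
      exact ⟨e, by rw [redNbr]⟩
  · rintro ⟨e, rfl⟩
    refine ⟨Sum.inr (Sum.inr e), 1, by norm_num, by simp, ?_, by rw [redNbr]⟩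
    intro u hu hc
    apply hblock
    rcases u with (v | f) | u
    · simp [blockIdx]
    · simp [blockIdx]
    · simp at hc
end

section
/- Let F be a finite simple graph on n vertices and c : V(F) → {1,…,n} a bijection. Let G be the graph obtained from the disjoint union of F and a complete graph Kₙ on vertex set {1,…,n} by adding, for each v ∈ F with c(v)=j and each i < j, the edge between v and vertex i of Kₙ if and only if v is not adjacent in F to the vertex of color i. Order V(G) by σ: vertex i of Kₙ gets position i, and v ∈ F gets position 2n − c(v) + 1. Let C color vertex i of Kₙ by i and v ∈ F by c(v). Then C is a proper coloring of G, the descents of (G,σ,C) are exactly the two-element sets {u,v} where uv is an edge of F, and consequently GDN(G,σ,C) equals the minimum size of a vertex cover of F. -/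
/-- The defining relation of the graph `G` obtained from the disjoint union of `F`
(vertices `Sum.inl`, vertex `v` having color `c v + 1` under the bijection
`c : α ≃ Fin n`) and a complete graph `Kₙ` (vertices `Sum.inr`, vertex `i` having
color `i + 1`): edges of `F`, all edges of `Kₙ`, and an edge between `v ∈ F` of color
`j` and vertex `i` of `Kₙ` with `i < j` iff `v` is not adjacent in `F` to the vertex of
color `i`. -/
def nipRel {α : Type*} {n : ℕ} (F : SimpleGraph α) (c : α ≃ Fin n) :
    (α ⊕ Fin n) → (α ⊕ Fin n) → Prop
  | Sum.inl u, Sum.inl v => F.Adj u v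
  | Sum.inr _, Sum.inr _ => True
  | Sum.inl v, Sum.inr i => (i : ℕ) < (c v : ℕ) ∧ ¬ F.Adj v (c.symm i)
  | Sum.inr _, Sum.inl _ => False

/-- The position of a vertex in the order `σ`: vertex `i` of `Kₙ` (of color `i + 1`)
gets position `i + 1`, and `v ∈ F` (of color `c v + 1`) gets position
`2n - (c v + 1) + 1 = 2n - c v`. -/
def nipPos {α : Type*} {n : ℕ} (c : α ≃ Fin n) : α ⊕ Fin n → ℕ :=
  Sum.elim (fun v => 2 * n - (c v : ℕ)) (fun i => (i : ℕ) + 1)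

/-- The coloring `C`: vertex `i` of `Kₙ` gets color `i + 1`, and `v ∈ F` gets color
`c v + 1`. -/
def nipCol {α : Type*} {n : ℕ} (c : α ≃ Fin n) : α ⊕ Fin n → ℕ :=
  Sum.elim (fun v => (c v : ℕ) + 1) (fun i => (i : ℕ) + 1)

theorem nip_ll {α : Type*} {n : ℕ} (F : SimpleGraph α) (c : α ≃ Fin n) (u v : α) :
    (SimpleGraph.fromRel (nipRel F c)).Adj (Sum.inl u) (Sum.inl v) ↔ F.Adj u v := by
  simp only [SimpleGraph.fromRel_adj, nipRel]
  constructor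
  · rintro ⟨_, h | h⟩
    · exact h
    · exact h.symm
  · intro h
    exact ⟨fun e => h.ne (Sum.inl.inj e), Or.inl h⟩

theorem nip_lr {α : Type*} {n : ℕ} (F : SimpleGraph α) (c : α ≃ Fin n) (v : α) (i : Fin n) :
    (SimpleGraph.fromRel (nipRel F c)).Adj (Sum.inl v) (Sum.inr i) ↔
      (i : ℕ) < (c v : ℕ) ∧ ¬ F.Adj v (c.symm i) := by
  simp [SimpleGraph.fromRel_adj, nipRel]

theorem nip_rr {α : Type*} {n : ℕ} (F : SimpleGraph α) (c : α ≃ Fin n) (i j : Fin n) :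
    (SimpleGraph.fromRel (nipRel F c)).Adj (Sum.inr i) (Sum.inr j) ↔ i ≠ j := by
  simp [SimpleGraph.fromRel_adj, nipRel]

theorem nip_proper {α : Type*} {n : ℕ} (F : SimpleGraph α) (c : α ≃ Fin n) (u v : α ⊕ Fin n)
    (h : (SimpleGraph.fromRel (nipRel F c)).Adj u v) : nipCol c u ≠ nipCol c v := by
  rcases u with u | i <;> rcases v with v | j
  · rw [nip_ll] at h
    intro e
    simp only [nipCol, Sum.elim_inl] at e
    exact h.ne (c.injective (Fin.ext (by omega)))
  · rw [nip_lr] at h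
    simp only [nipCol, Sum.elim_inl, Sum.elim_inr]
    omega
  · have h := h.symm
    rw [nip_lr] at h
    simp only [nipCol, Sum.elim_inl, Sum.elim_inr]
    omega
  · rw [nip_rr] at h
    intro e
    simp only [nipCol, Sum.elim_inr] at e
    exact h (Fin.ext (by omega))

/-- For every vertex and smaller color, either a smaller neighbor has this color, or the vertex
is `inl v`, and its only neighbor of that color is `inl u` with `u` adjacent to `v`. -/
theorem nip_key {α : Type*} {n : ℕ} (F : SimpleGraph α) (c : α ≃ Fin n) (x : α ⊕ Fin n) (i : ℕ)
    (h0 : 0 < i) (hi : i < nipCol c x) :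
    (∃ u, (SimpleGraph.fromRel (nipRel F c)).Adj x u ∧ nipCol c u = i ∧ nipPos c u < nipPos c x) ∨
    ∃ v u, x = Sum.inl v ∧ F.Adj v u ∧ (c u : ℕ) + 1 = i := by
  rcases x with v | j
  · simp only [nipCol, Sum.elim_inl] at hi
    have hv := (c v).2
    have hin : i - 1 < n := by omega
    by_cases ha : F.Adj v (c.symm ⟨i - 1, hin⟩)
    · right
      exact ⟨v, _, rfl, ha, by simp; omega⟩
    · left
      refine ⟨Sum.inr ⟨i - 1, hin⟩, ?_, ?_, ?_⟩
      · rw [nip_lr]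
        exact ⟨by simp; omega, ha⟩
      · simp [nipCol]; omega
      · simp [nipPos]; omega
  · simp only [nipCol, Sum.elim_inr] at hi
    have hj := j.2
    left
    refine ⟨Sum.inr ⟨i - 1, by omega⟩, ?_, ?_, ?_⟩
    · rw [nip_rr]
      intro e
      have := congrArg Fin.val e
      simp at this
      omega
    · simp [nipCol]; omega
    · simp [nipPos]; omega

theorem nip_nbr {α : Type*} {n : ℕ} (F : SimpleGraph α) (c : α ≃ Fin n) (v u : α)
    (h : F.Adj v u) (x : α ⊕ Fin n) :
    (SimpleGraph.fromRel (nipRel F c)).Adj (Sum.inl v) x ∧ nipCol c x = (c u : ℕ) + 1 ↔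
      x = Sum.inl u := by
  constructor
  · rintro ⟨h1, h2⟩
    rcases x with w | j
    · simp only [nipCol, Sum.elim_inl] at h2
      rw [c.injective (Fin.ext (by omega) : c w = c u)]
    · simp only [nipCol, Sum.elim_inr] at h2
      rw [nip_lr] at h1
      have : j = c u := Fin.ext (by omega)
      subst this
      simp [h] at h1
  · rintro rfl
    exact ⟨(nip_ll F c v u).2 h, rfl⟩

theorem nip_pos_lt {α : Type*} {n : ℕ} (c : α ≃ Fin n) (v u : α) (h : (c u : ℕ) < c v) :
    nipPos c (Sum.inl v) < nipPos c (Sum.inl u) := by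
  have := (c v).2
  simp only [nipPos, Sum.elim_inl]
  omega

theorem nip_lt_or {α : Type*} {n : ℕ} (F : SimpleGraph α) (c : α ≃ Fin n) (u v : α)
    (h : F.Adj u v) : (c u : ℕ) < c v ∨ (c v : ℕ) < c u := by
  rcases lt_trichotomy (c u : ℕ) (c v) with h' | h' | h'
  · exact Or.inl h'
  · exact absurd (c.injective (Fin.ext h')) h.ne
  · exact Or.inr h'

theorem nip_descent {α : Type*} {n : ℕ} (F : SimpleGraph α) (c : α ≃ Fin n)
    (D : Set (α ⊕ Fin n)) :
    IsDescent (SimpleGraph.fromRel (nipRel F c))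
          (fun x y => nipPos c x < nipPos c y) (nipCol c) D ↔
        ∃ u v, F.Adj u v ∧ D = {Sum.inl u, Sum.inl v} := by
  constructor
  · rintro ⟨x, i, h0, hi, hlt, rfl⟩
    rcases nip_key F c x i h0 hi with ⟨u, h1, h2, h3⟩ | ⟨v, u, rfl, h, rfl⟩
    · exact absurd (hlt u h1 h2) (by simpa using h3.le)
    · refine ⟨v, u, h, ?_⟩
      simp only [nip_nbr F c v u h]
      rfl
  · have main : ∀ v u, F.Adj v u → (c u : ℕ) < c v →
        IsDescent (SimpleGraph.fromRel (nipRel F c))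
          (fun x y => nipPos c x < nipPos c y) (nipCol c) {Sum.inl v, Sum.inl u} := by
      intro v u h hl
      refine ⟨Sum.inl v, (c u : ℕ) + 1, by omega, by simpa [nipCol] using hl, ?_, ?_⟩
      · intro x h1 h2
        obtain rfl := (nip_nbr F c v u h x).1 ⟨h1, h2⟩
        exact nip_pos_lt c v u hl
      · simp only [nip_nbr F c v u h]
        rfl
    rintro ⟨u, v, h, rfl⟩
    rcases nip_lt_or F c u v h with hl | hl
    · rw [Set.pair_comm]
      exact main v u h.symm hl
    · exact main u v h hl

theorem nip_gds {α : Type*} {n : ℕ} (F : SimpleGraph α) (c : α ≃ Fin n)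
    (S : Set (α ⊕ Fin n)) :
    IsGreedyDS (SimpleGraph.fromRel (nipRel F c))
          (fun x y => nipPos c x < nipPos c y) S (nipCol c) ↔
        ∀ u v, F.Adj u v → Sum.inl u ∈ S ∨ Sum.inl v ∈ S := by
  constructor
  · intro hS
    have main : ∀ v u, F.Adj v u → (c u : ℕ) < c v → Sum.inl v ∈ S ∨ Sum.inl u ∈ S := by
      intro v u h hl
      by_contra hc
      rw [not_or] at hc
      have e := hS (Sum.inl v) hc.1
      have hlt : (c u : ℕ) + 1 < nipCol c (Sum.inl v) := by simpa [nipCol] using hl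
      rw [e] at hlt
      refine Nat.notMem_of_lt_sInf hlt ⟨by omega, ?_⟩
      intro x h1 h2 h3
      obtain rfl := (nip_nbr F c v u h x).1 ⟨h1, h3⟩
      rcases h2 with h2 | h2
      · exact hc.2 h2
      · exact lt_asymm h2 (nip_pos_lt c v u hl)
    intro u v h
    rcases nip_lt_or F c u v h with hl | hl
    · exact (main v u h.symm hl).symm
    · exact main u v h hl
  · intro hK x hx
    have hmem : nipCol c x ∈ {k : ℕ | 0 < k ∧ ∀ u, (SimpleGraph.fromRel (nipRel F c)).Adj x u →
        (u ∈ S ∨ nipPos c u < nipPos c x) → nipCol c u ≠ k} := by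
      refine ⟨by rcases x with x | x <;> simp [nipCol], ?_⟩
      intro u h _
      exact (nip_proper F c x u h).symm
    refine le_antisymm (le_csInf ⟨_, hmem⟩ ?_) (Nat.sInf_le hmem)
    rintro k ⟨h0, hk⟩
    by_contra hlt
    rw [not_le] at hlt
    rcases nip_key F c x k h0 hlt with ⟨u, h1, h2, h3⟩ | ⟨v, u, rfl, h, rfl⟩
    · exact hk u h1 (Or.inr h3) h2
    · exact hk (Sum.inl u) ((nip_ll F c v u).2 h) (Or.inl ((hK v u h).resolve_left hx)) rfl

/-- for a finite graph `F` on `n` vertices with a bijective coloring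
`c : V(F) ≃ Fin n`, in the graph `G` built from `F` and `Kₙ` with the stated order and
coloring: `C` is proper, the descents are exactly the pairs `{u, v}` with `uv ∈ E(F)`,
and `GDN(G, σ, C)` equals the minimum size of a vertex cover of `F`. -/
theorem reduction_from_complete_graph {α : Type*} [Fintype α] {n : ℕ}
    (F : SimpleGraph α) (c : α ≃ Fin n) :
    (∀ u v, (SimpleGraph.fromRel (nipRel F c)).Adj u v → nipCol c u ≠ nipCol c v) ∧
    (∀ D : Set (α ⊕ Fin n),
      IsDescent (SimpleGraph.fromRel (nipRel F c))
          (fun x y => nipPos c x < nipPos c y) (nipCol c) D ↔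
        ∃ u v, F.Adj u v ∧ D = {Sum.inl u, Sum.inl v}) ∧
    gdnColored (SimpleGraph.fromRel (nipRel F c))
        (fun x y => nipPos c x < nipPos c y) (nipCol c) = minVertexCover F := by
  refine ⟨nip_proper F c, nip_descent F c, ?_⟩
  unfold gdnColored minVertexCover
  simp only [nip_gds F c]
  apply le_antisymm
  · refine le_csInf ⟨_, Set.univ, by simp, rfl⟩ ?_
    rintro k ⟨K, hK, rfl⟩
    refine Nat.sInf_le ⟨Sum.inl '' K, ?_, Set.ncard_image_of_injective _ Sum.inl_injective⟩
    intro u v h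
    simpa using hK u v h
  · refine le_csInf ⟨_, Set.univ, by simp, rfl⟩ ?_
    rintro k ⟨S, hS, rfl⟩
    refine le_trans (b := (Sum.inl ⁻¹' S : Set α).ncard)
      (Nat.sInf_le ⟨Sum.inl ⁻¹' S, hS, rfl⟩) ?_
    rw [← Set.ncard_image_of_injective _ (Sum.inl_injective (α := α) (β := Fin n))]
    exact Set.ncard_le_ncard (Set.image_preimage_subset _ _) (Set.toFinite _)
end

section
/- Let L be an n×n Latin square and let E(L) be the graph on the n² cells of L in which two cells (i,k) and (r,j) with L(i,k)=L(r,j), i<r and j<k are adjacent if and only if L(i,j) > L(i,k). If D is a set of cells of L that is a vertex cover of E(L), then D is a greedy defining set of L. -/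
theorem latin_line_surj {n : ℕ} (f : Fin n → ℕ) (hf : ∀ i, f i ∈ Finset.Icc 1 n)
    (hi : Function.Injective f) (c : ℕ) (h0 : 0 < c) (hc : c ≤ n) : ∃ i, f i = c := by
  have h : Finset.univ.image f = Finset.Icc 1 n := by
    apply Finset.eq_of_subset_of_card_le
    · intro x hx
      obtain ⟨i, -, rfl⟩ := Finset.mem_image.1 hx
      exact hf i
    · rw [Finset.card_image_of_injective _ hi]
      simp
  have hm : c ∈ Finset.univ.image f := by
    rw [h]
    exact Finset.mem_Icc.2 ⟨h0, hc⟩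
  obtain ⟨i, -, e⟩ := Finset.mem_image.1 hm
  exact ⟨i, e⟩

/-- if `D` is a vertex cover of the graph `E(L)` on the cells of `L`, in
which two cells `(i,k)` and `(r,j)` with the same entry, `i < r` and `j < k` are
adjacent iff `L i j > L i k`, then `D` is a greedy defining set of `L`. -/
theorem vertexCover_entryGraph_isLatinGDS {n : ℕ} (L : Fin n → Fin n → ℕ)
    (hL : IsLatin n L) (D : Set (Fin n × Fin n))
    (hcover : ∀ i r j k : Fin n, i < r → j < k → L i k = L r j → L i k < L i j →
      ((i, k) ∈ D ∨ (r, j) ∈ D)) :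
    IsLatinGDS L D := by
  obtain ⟨hr, hrow, hcol⟩ := hL
  rintro ⟨i, j⟩ hp
  have hv := Finset.mem_Icc.1 (hr i j)
  symm
  apply IsLeast.csInf_eq
  refine ⟨⟨hv.1, ?_⟩, ?_⟩
  · rintro ⟨a, b⟩ hne hab - heq
    rcases hab with h | h
    · simp only at h heq
      subst h
      exact hne (by rw [hrow _ heq])
    · simp only at h heq
      subst h
      exact hne (by rw [hcol _ heq])
  · rintro c ⟨h0, hc⟩
    by_contra hlt
    simp only [not_le] at hlt
    obtain ⟨k, hk⟩ := latin_line_surj (L i) (hr i) (hrow i) c h0 (by omega)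
    obtain ⟨r, hrr⟩ := latin_line_surj (fun r => L r j) (fun r => hr r j) (hcol j) c h0 (by omega)
    have hkj : k ≠ j := by
      rintro rfl
      omega
    have hri : r ≠ i := by
      rintro rfl
      omega
    have h1 : ¬ ((i, k) ∈ D ∨ cellEarlier (i, k) (i, j)) := fun h =>
      hc (i, k) (by simpa using hkj) (Or.inl rfl) h hk
    have h2 : ¬ ((r, j) ∈ D ∨ cellEarlier (r, j) (i, j)) := fun h =>
      hc (r, j) (by simpa using hri) (Or.inr rfl) h hrr
    simp only [cellEarlier, not_or, not_and, not_lt] at h1 h2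
    have hjk : j < k := lt_of_le_of_ne (h1.2.2 trivial) hkj.symm
    have hir : i < r := lt_of_le_of_ne h2.2.1 hri.symm
    rcases hcover i r j k hir hjk (hk.trans hrr.symm) (by omega) with h | h
    · exact h1.1 h
    · exact h2.1 h
end

section
/- Let L be an n×n Latin square and let R(L) be the graph on the n² cells of L in which two cells of the same row r, say (r,c_j) with entry j = L(r,c_j) and (r,c_i) with entry i = L(r,c_i) and i < j, are adjacent if and only if c_j < c_i and the cell of column c_j containing entry i lies in a row strictly below r. If D is a set of cells of L that is a vertex cover of R(L), then D is a greedy defining set of L. -/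
theorem latin_surj_aux {n : ℕ} (f : Fin n → ℕ) (hf : Function.Injective f)
    (hm : ∀ i, f i ∈ Finset.Icc 1 n) (c : ℕ) (hc : c ∈ Finset.Icc 1 n) : ∃ i, f i = c := by
  have h : Finset.univ.image f = Finset.Icc 1 n := by
    apply Finset.eq_of_subset_of_card_le
    · intro x hx
      obtain ⟨i, _, rfl⟩ := Finset.mem_image.1 hx
      exact hm i
    · rw [Finset.card_image_of_injective _ hf]
      simp
  rw [← h] at hc
  obtain ⟨i, _, hi⟩ := Finset.mem_image.1 hc
  exact ⟨i, hi⟩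

/-- if `D` is a vertex cover of the graph `R(L)` on the cells of `L`, in
which two cells `(r, cj)` and `(r, ci)` of the same row `r` with `L r ci < L r cj` are
adjacent iff `cj < ci` and the cell of column `cj` containing the entry `L r ci` lies
in a row `r'` strictly below `r`, then `D` is a greedy defining set of `L`. -/
theorem vertexCover_rowGraph_isLatinGDS {n : ℕ} (L : Fin n → Fin n → ℕ)
    (hL : IsLatin n L) (D : Set (Fin n × Fin n))
    (hcover : ∀ r cj ci r' : Fin n, cj < ci → L r ci < L r cj → L r' cj = L r ci →
      r < r' → ((r, cj) ∈ D ∨ (r, ci) ∈ D)) :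
    IsLatinGDS L D := by
  obtain ⟨hm, hr, hcol⟩ := hL
  rintro ⟨r, c⟩ hp
  have hrc := Finset.mem_Icc.1 (hm r c)
  symm
  refine IsLeast.csInf_eq ⟨⟨hrc.1, ?_⟩, ?_⟩
  · rintro ⟨a, b⟩ hne hab _ heq
    dsimp only at hab heq
    rcases hab with rfl | rfl
    · exact hne (by rw [hr a heq])
    · exact hne (by rw [hcol b heq])
  · rintro k ⟨hk, hall⟩
    by_contra hlt
    dsimp only at hlt
    have hk' : k ∈ Finset.Icc 1 n := Finset.mem_Icc.2 ⟨hk, by omega⟩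
    obtain ⟨ci, hci⟩ := latin_surj_aux (L r) (hr r) (hm r) k hk'
    obtain ⟨r', hr'⟩ := latin_surj_aux (fun i => L i c) (hcol c) (fun i => hm i c) k hk'
    have h1 : ci ≠ c := by rintro rfl; omega
    have h2 : r' ≠ r := by rintro rfl; omega
    rcases lt_or_gt_of_ne h1 with h | h
    · exact hall (r, ci) (by simp [h1]) (Or.inl rfl) (Or.inr (Or.inr ⟨rfl, h⟩)) hci
    rcases lt_or_gt_of_ne h2 with h' | h'
    · exact hall (r', c) (by simp [h2]) (Or.inr rfl) (Or.inr (Or.inl h')) hr'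
    rcases hcover r c ci r' h (by omega) (by omega) h' with hd | hd
    · exact hp hd
    · exact hall (r, ci) (by simp [h1]) (Or.inl rfl) (Or.inl hd) hci
end

section
/- Let L be an n×n Latin square and let C(L) be the graph on the n² cells of L in which two cells of the same column c, say (a,c) with entry y = L(a,c) and (a′,c) with entry x = L(a′,c) and x < y, are adjacent if and only if a < a′ and the cell of row a containing entry x lies in a column strictly to the right of c. If D is a set of cells of L that is a vertex cover of C(L), then D is a greedy defining set of L. -/
/-- if `D` is a vertex cover of the graph `C(L)` on the cells of `L`, in
which two cells `(a, c)` and `(a', c)` of the same column `c` with `L a' c < L a c` are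
adjacent iff `a < a'` and the cell of row `a` containing the entry `L a' c` lies in a
column `c'` strictly to the right of `c`, then `D` is a greedy defining set of `L`. -/
theorem vertexCover_columnGraph_isLatinGDS {n : ℕ} (L : Fin n → Fin n → ℕ)
    (hL : IsLatin n L) (D : Set (Fin n × Fin n))
    (hcover : ∀ a a' col c' : Fin n, a < a' → L a' col < L a col → L a c' = L a' col →
      col < c' → ((a, col) ∈ D ∨ (a', col) ∈ D)) :
    IsLatinGDS L D := by
  obtain ⟨hr, hrow, hcol⟩ := hL
  have surj : ∀ f : Fin n → ℕ, (∀ i, f i ∈ Finset.Icc 1 n) → Function.Injective f →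
      ∀ x ∈ Finset.Icc 1 n, ∃ i, f i = x := by
    intro f hf hinj x hx
    have himg : Finset.univ.image f = Finset.Icc 1 n := by
      apply Finset.eq_of_subset_of_card_le
      · intro y hy
        obtain ⟨i, -, rfl⟩ := Finset.mem_image.1 hy
        exact hf i
      · rw [Finset.card_image_of_injective _ hinj]
        simp
    rw [← himg] at hx
    obtain ⟨i, -, h⟩ := Finset.mem_image.1 hx
    exact ⟨i, h⟩
  rintro ⟨a, c⟩ hp
  symm
  apply IsLeast.csInf_eq
  constructor
  · refine ⟨(Finset.mem_Icc.1 (hr a c)).1, ?_⟩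
    rintro ⟨a', c'⟩ hne hq - heq
    apply hne
    rcases hq with h | h
    · simp only at h heq
      subst h
      rw [hrow _ heq]
    · simp only at h heq
      subst h
      rw [hcol _ heq]
  · rintro x ⟨hx0, hx⟩
    by_contra hlt
    simp only [not_le] at hlt
    have hxm : x ∈ Finset.Icc 1 n := by
      have := Finset.mem_Icc.1 (hr a c)
      rw [Finset.mem_Icc]
      omega
    obtain ⟨c', hc'⟩ := surj (L a) (hr a) (hrow a) x hxm
    obtain ⟨a', ha'⟩ := surj (fun i => L i c) (fun i => hr i c) (hcol c) x hxm
    have hcc : c' ≠ c := by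
      rintro rfl
      omega
    have haa : a' ≠ a := by
      rintro rfl
      omega
    rcases lt_or_gt_of_ne hcc with h | h
    · exact hx (a, c') (by simp [hcc]) (Or.inl rfl) (Or.inr (Or.inr ⟨rfl, h⟩)) hc'
    rcases lt_or_gt_of_ne haa with h2 | h2
    · exact hx (a', c) (by simp [haa]) (Or.inr rfl) (Or.inr (Or.inl h2)) ha'
    rcases hcover a a' c c' h2 (by omega) (by omega) h with h3 | h3
    · exact hp h3
    · exact hx (a', c) (by simp [haa]) (Or.inr rfl) (Or.inl h3) ha'
end

section
/- Every n×n Latin square (n ≥ 1) contains a greedy defining set of size at most n² − (n·log(4n))/4, where log denotes the natural logarithm. -/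
open Finset in
/-- Rounding a function affine in each coordinate. -/
theorem gds_round {V : Type*} [DecidableEq V] (g : (V → ℝ) → ℝ)
    (hg : ∀ x v t, g (Function.update x v t) =
      (1 - t) * g (Function.update x v 0) + t * g (Function.update x v 1))
    (p : ℝ) (hp0 : 0 ≤ p) (hp1 : p ≤ 1) (W : Finset V) :
    ∃ y : V → ℝ, (∀ v ∉ W, y v = p) ∧ (∀ v ∈ W, y v = 0 ∨ y v = 1) ∧ g (fun _ => p) ≤ g y := by
  induction W using Finset.induction_on with
  | empty => exact ⟨fun _ => p, by simp⟩
  | insert a W ha ih =>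
    obtain ⟨y, h1, h2, h3⟩ := ih
    have key : ∃ t : ℝ, (t = 0 ∨ t = 1) ∧ g y ≤ g (Function.update y a t) := by
      by_contra hcon
      have c0 : g (Function.update y a 0) < g y := by
        by_contra h; exact hcon ⟨0, Or.inl rfl, not_lt.mp h⟩
      have c1 : g (Function.update y a 1) < g y := by
        by_contra h; exact hcon ⟨1, Or.inr rfl, not_lt.mp h⟩
      have := hg y a p
      have e : Function.update y a p = y := by
        rw [← h1 a ha]; exact Function.update_eq_self a y
      rw [e] at this
      rcases hp0.eq_or_lt with h | h
      · rw [← h] at this; linarith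
      · nlinarith
    obtain ⟨t, ht, hle⟩ := key
    refine ⟨Function.update y a t, ?_, ?_, h3.trans hle⟩
    · intro v hv
      simp only [Finset.mem_insert, not_or] at hv
      rw [Function.update_of_ne hv.1]; exact h1 v hv.2
    · intro v hv
      by_cases hva : v = a
      · subst hva; simpa using ht
      · rw [Function.update_of_ne hva]
        exact h2 v ((Finset.mem_insert.mp hv).resolve_left hva)

/-- Large independent sets in 3-uniform hypergraphs. -/
theorem gds_indep {V : Type*} [Fintype V] [DecidableEq V] (E : Finset (V × V × V))
    (hE : ∀ e ∈ E, e.1 ≠ e.2.1 ∧ e.1 ≠ e.2.2 ∧ e.2.1 ≠ e.2.2)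
    (p : ℝ) (hp0 : 0 ≤ p) (hp1 : p ≤ 1) :
    ∃ S : Finset V, (∀ e ∈ E, ¬ (e.1 ∈ S ∧ e.2.1 ∈ S ∧ e.2.2 ∈ S)) ∧
      (Fintype.card V : ℝ) * p - E.card * p ^ 3 ≤ S.card := by
  let g : (V → ℝ) → ℝ := fun x => ∑ v, x v - ∑ e ∈ E, x e.1 * x e.2.1 * x e.2.2
  obtain ⟨y, -, h2, h3⟩ := gds_round g (by
    intro x v t
    simp only [g]
    rw [mul_sub, mul_sub, Finset.mul_sum, Finset.mul_sum, Finset.mul_sum, Finset.mul_sum]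
    have e1 : ∀ u, Function.update x v t u =
        (1 - t) * Function.update x v 0 u + t * Function.update x v 1 u := by
      intro u
      by_cases h : u = v
      · subst h; simp
      · simp only [Function.update_of_ne h]; ring
    have e2 : ∀ e ∈ E, Function.update x v t e.1 * Function.update x v t e.2.1 *
        Function.update x v t e.2.2 =
        (1 - t) * (Function.update x v 0 e.1 * Function.update x v 0 e.2.1 *
          Function.update x v 0 e.2.2) +
        t * (Function.update x v 1 e.1 * Function.update x v 1 e.2.1 *
          Function.update x v 1 e.2.2) := by
      rintro ⟨a, b, c⟩ he
      obtain ⟨hab, hac, hbc⟩ := hE _ he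
      simp only at hab hac hbc ⊢
      simp only [Function.update_apply]
      by_cases ha : a = v
      · subst ha
        simp [hab.symm, hac.symm]
        ring
      · by_cases hb : b = v
        · subst hb
          simp [hab, hbc.symm]
          ring
        · by_cases hc : c = v
          · subst hc
            simp [hac, hbc]
            ring
          · simp [ha, hb, hc]
            ring
    rw [Finset.sum_congr rfl e2, Finset.sum_congr rfl (fun u _ => e1 u),
      Finset.sum_add_distrib, Finset.sum_add_distrib]
    ring) p hp0 hp1 Finset.univ
  let T : Finset V := Finset.univ.filter (fun v => y v = 1)
  let F : Finset (V × V × V) := E.filter (fun e => e.1 ∈ T ∧ e.2.1 ∈ T ∧ e.2.2 ∈ T)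
  have hy : ∀ v, y v = if v ∈ T then 1 else 0 := by
    intro v
    by_cases h : y v = 1
    · simp [T, h]
    · have := (h2 v (Finset.mem_univ v)).resolve_right h
      simp [T, this]
  refine ⟨T \ F.image Prod.fst, ?_, ?_⟩
  · rintro e he ⟨ha, hb, hc⟩
    rw [Finset.mem_sdiff] at ha hb hc
    exact ha.2 (Finset.mem_image.mpr ⟨e, Finset.mem_filter.mpr ⟨he, ha.1, hb.1, hc.1⟩, rfl⟩)
  · have hgp : g (fun _ => p) = (Fintype.card V : ℝ) * p - E.card * p ^ 3 := by
      simp only [g, Finset.sum_const, Finset.card_univ, nsmul_eq_mul]; ring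
    have hgy : g y = (T.card : ℝ) - F.card := by
      simp only [g]
      congr 1
      · rw [Finset.sum_congr rfl (fun v _ => hy v)]; simp
      · rw [Finset.card_filter]
        push_cast
        refine Finset.sum_congr rfl fun e _ => ?_
        rw [hy, hy, hy]
        by_cases h1 : e.1 ∈ T <;> by_cases h2 : e.2.1 ∈ T <;> by_cases h3 : e.2.2 ∈ T <;>
          simp [h1, h2, h3]
    rw [← hgp]
    refine h3.trans ?_
    rw [hgy]
    have h4 : T.card ≤ (T \ F.image Prod.fst).card + F.card := by
      have a1 := Finset.le_card_sdiff (F.image Prod.fst) T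
      have a2 : (F.image Prod.fst).card ≤ F.card := Finset.card_image_le
      omega
    have : (T.card : ℝ) ≤ (T \ F.image Prod.fst).card + F.card := by exact_mod_cast h4
    linarith

theorem gds_surj {n : ℕ} (f : Fin n → ℕ) (hf : Function.Injective f)
    (hm : ∀ j, f j ∈ Finset.Icc 1 n) (c : ℕ) (hc : c ∈ Finset.Icc 1 n) : ∃ j, f j = c := by
  have h : Finset.univ.image f = Finset.Icc 1 n := by
    apply Finset.eq_of_subset_of_card_le
    · intro x hx
      obtain ⟨j, -, rfl⟩ := Finset.mem_image.mp hx
      exact hm j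
    · rw [Finset.card_image_of_injective _ hf]; simp
  rw [← h] at hc
  obtain ⟨j, -, hj⟩ := Finset.mem_image.mp hc
  exact ⟨j, hj⟩

theorem gds_num {n : ℕ} (hn : 1 ≤ n) : ∃ p : ℝ, 0 ≤ p ∧ p ≤ 1 ∧
    (n : ℝ) * Real.log (4 * (n : ℝ)) / 4 ≤ (n : ℝ) ^ 2 * p - (n : ℝ) ^ 3 * p ^ 3 := by
  have hn' : (1 : ℝ) ≤ n := by exact_mod_cast hn
  obtain ⟨s, hs, hns⟩ : ∃ s : ℝ, 1 ≤ s ∧ (n : ℝ) = s ^ 2 :=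
    ⟨√n, by rwa [Real.one_le_sqrt], (Real.sq_sqrt (by linarith)).symm⟩
  have hs0 : 0 < s := by linarith
  refine ⟨3 / (5 * s), by positivity, ?_, ?_⟩
  · rw [div_le_one (by positivity)]; linarith
  · rw [hns]
    have e : (s ^ 2) ^ 2 * (3 / (5 * s)) - (s ^ 2) ^ 3 * (3 / (5 * s)) ^ 3
        = s ^ 2 * (48 / 125 * s) := by
      field_simp; ring
    rw [e, mul_div_assoc]
    apply mul_le_mul_of_nonneg_left _ (by positivity)
    have l1 : Real.log (4 * s ^ 2) = 2 * Real.log (2 * s) := by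
      rw [show 4 * s ^ 2 = (2 * s) ^ 2 by ring, Real.log_pow]; norm_num
    have l2 : Real.log (2 * s) ≤ 2 * s / Real.exp 1 := by
      have := Real.log_le_sub_one_of_pos (show 0 < 2 * s / Real.exp 1 by positivity)
      rw [Real.log_div (by positivity) (by positivity), Real.log_exp] at this
      linarith
    have l3 : 2 * s / Real.exp 1 ≤ 2 * s * (48 / 125) := by
      rw [div_le_iff₀ (by positivity)]
      have := Real.exp_one_gt_d9
      nlinarith
    rw [l1]; linarith

/-- every `n × n` Latin square (`n ≥ 1`) contains a greedy defining set of
size at most `n² - (n · log (4n)) / 4`, where `log` is the natural logarithm. -/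
theorem latin_gds_size_bound {n : ℕ} (hn : 1 ≤ n) (L : Fin n → Fin n → ℕ)
    (hL : IsLatin n L) :
    ∃ D : Set (Fin n × Fin n), IsLatinGDS L D ∧
      (D.ncard : ℝ) ≤ (n : ℝ) ^ 2 - (n : ℝ) * Real.log (4 * (n : ℝ)) / 4 := by
  obtain ⟨hm, hr, hc⟩ := hL
  obtain ⟨p, hp0, hp1, hp⟩ := gds_num hn
  let E : Finset ((Fin n × Fin n) × (Fin n × Fin n) × (Fin n × Fin n)) :=
    Finset.univ.filter (fun e => e.2.1.1 = e.1.1 ∧ e.2.2.2 = e.1.2 ∧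
      e.1.2 < e.2.1.2 ∧ e.1.1 < e.2.2.1 ∧ L e.2.1.1 e.2.1.2 = L e.2.2.1 e.2.2.2)
  have hEc : E.card ≤ n ^ 3 := by
    have : E.card ≤ (Finset.univ : Finset (Fin n × Fin n × Fin n)).card := by
      apply Finset.card_le_card_of_injOn (fun e => (e.1.1, e.1.2, e.2.1.2)) (by simp)
      rintro ⟨⟨a, b⟩, ⟨c, d⟩, ⟨f, g⟩⟩ h1 ⟨⟨a', b'⟩, ⟨c', d'⟩, ⟨f', g'⟩⟩ h2 h
      simp only [E, Finset.coe_filter, Finset.mem_univ, true_and, Set.mem_setOf_eq] at h1 h2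
      simp only [Prod.mk.injEq] at h
      obtain ⟨rfl, rfl, rfl⟩ := h
      obtain ⟨rfl, rfl, -, -, h1⟩ := h1
      obtain ⟨rfl, rfl, -, -, h2⟩ := h2
      have := hc _ (h1.symm.trans h2)
      simp [this]
    refine this.trans (le_of_eq ?_)
    simp only [Finset.card_univ, Fintype.card_prod, Fintype.card_fin]; ring
  obtain ⟨S, hS, hSc⟩ := gds_indep E (by
    rintro ⟨⟨a, b⟩, ⟨c, d⟩, ⟨f, g⟩⟩ h
    simp only [E, Finset.mem_filter, Finset.mem_univ, true_and] at h
    obtain ⟨rfl, rfl, h1, h2, -⟩ := h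
    simp only [ne_eq, Prod.mk.injEq, not_and]
    exact ⟨fun _ => h1.ne, fun h => absurd h h2.ne, fun h => absurd h h2.ne⟩) p hp0 hp1
  refine ⟨((Sᶜ : Finset _) : Set (Fin n × Fin n)), ?_, ?_⟩
  · rintro ⟨i, j⟩ hpS
    simp only [Finset.coe_compl, Set.mem_compl_iff, Finset.mem_coe, not_not] at hpS
    symm
    apply IsLeast.csInf_eq
    constructor
    · refine ⟨?_, ?_⟩
      · have := Finset.mem_Icc.mp (hm i j); simp only; omega
      · rintro ⟨a, b⟩ hne hrc - heq
        rcases hrc with h | h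
        · simp only at h heq; subst h
          exact hne (by rw [hr _ heq])
        · simp only at h heq; subst h
          exact hne (by rw [hc _ heq])
    · rintro c ⟨hc0, hcq⟩
      by_contra hlt
      simp only [not_le] at hlt
      have hcm : c ∈ Finset.Icc 1 n := by
        have := Finset.mem_Icc.mp (hm i j)
        rw [Finset.mem_Icc]; omega
      obtain ⟨j', hj'⟩ := gds_surj (L i) (hr i) (hm i) c hcm
      obtain ⟨i', hi'⟩ := gds_surj (fun i => L i j) (hc j) (fun i => hm i j) c hcm
      have hjj : j' ≠ j := by rintro rfl; omega
      have hii : i' ≠ i := by rintro rfl; omega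
      have A : (i, j') ∈ S ∧ j < j' := by
        have h : ¬ _ := fun h => hcq (i, j') (by simp [hjj]) (Or.inl rfl) h hj'
        simp only [Finset.coe_compl, Set.mem_compl_iff, Finset.mem_coe, cellEarlier,
          lt_irrefl, true_and, false_or, not_or, not_not, not_lt] at h
        exact ⟨h.1, lt_of_le_of_ne h.2 hjj.symm⟩
      have B : (i', j) ∈ S ∧ i < i' := by
        have h : ¬ _ := fun h => hcq (i', j) (by simp [hii]) (Or.inr rfl) h hi'
        simp only [Finset.coe_compl, Set.mem_compl_iff, Finset.mem_coe, cellEarlier,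
          lt_irrefl, and_false, or_false, not_or, not_not, not_lt] at h
        exact ⟨h.1, lt_of_le_of_ne h.2 hii.symm⟩
      refine hS ((i, j), (i, j'), (i', j)) ?_ ⟨hpS, A.1, B.1⟩
      simp only [E, Finset.mem_filter, Finset.mem_univ, true_and]
      exact ⟨A.2, B.2, hj'.trans hi'.symm⟩
  · rw [Set.ncard_coe_finset, Finset.card_compl, Nat.cast_sub (Finset.card_le_univ S)]
    have hE' : (E.card : ℝ) ≤ (n : ℝ) ^ 3 := by exact_mod_cast hEc
    have hV : (Fintype.card (Fin n × Fin n) : ℝ) = (n : ℝ) ^ 2 := by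
      simp [sq]
    rw [hV] at hSc ⊢
    have := mul_le_mul_of_nonneg_right hE' (pow_nonneg hp0 3)
    linarith
end

section
/- Let L be an n×n Latin square and e ∈ {1,…,n}. Let G[e] be the graph whose vertices are the n cells of L with entry e, where two such cells (i,k) and (r,j) with i<r and j<k are adjacent if and only if L(i,j) > e. Then G[e] has at most n(n−1)/2 − e(e−1)/2 edges. -/
theorem sum_min_aux (d e : ℕ) :
    ∑ k ∈ Finset.range (d + e), min d k + ∑ k ∈ Finset.range e, k
      = ∑ k ∈ Finset.range (d + e), k := by
  induction e with
  | zero =>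
    simp only [add_zero, Finset.range_zero, Finset.sum_empty]
    apply Finset.sum_congr rfl
    intro k hk
    have := Finset.mem_range.1 hk
    omega
  | succ e ih =>
    rw [← add_assoc, Finset.sum_range_succ, Finset.sum_range_succ, Finset.sum_range_succ]
    omega

/-- in the graph `G[e]` on the `n` cells of `L` with entry `e`, in which two
such cells `(i, k)` and `(r, j)` with `i < r` and `j < k` are adjacent iff `L i j > e`,
there are at most `n(n-1)/2 - e(e-1)/2` edges.  (Each edge is recorded exactly once, as
the ordered pair `((i, k), (r, j))` with `i < r` and `j < k`.) -/
theorem entry_graph_edge_bound {n : ℕ} (L : Fin n → Fin n → ℕ) (hL : IsLatin n L)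
    (e : ℕ) (he : e ∈ Finset.Icc 1 n) :
    Set.ncard {p : (Fin n × Fin n) × (Fin n × Fin n) |
        p.1.1 < p.2.1 ∧ p.2.2 < p.1.2 ∧
        L p.1.1 p.1.2 = e ∧ L p.2.1 p.2.2 = e ∧ e < L p.1.1 p.2.2} ≤
      n * (n - 1) / 2 - e * (e - 1) / 2 := by
  classical
  obtain ⟨h1, h2, h3⟩ := hL
  have he' := Finset.mem_Icc.1 he
  rw [Set.ncard_eq_toFinset_card']
  set S := Set.toFinset {p : (Fin n × Fin n) × (Fin n × Fin n) |
        p.1.1 < p.2.1 ∧ p.2.2 < p.1.2 ∧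
        L p.1.1 p.1.2 = e ∧ L p.2.1 p.2.2 = e ∧ e < L p.1.1 p.2.2} with hS
  have key : S.card ≤ ∑ k : Fin n, min (n - e) (k : ℕ) := by
    rw [Finset.card_eq_sum_card_fiberwise (f := fun p => p.1.2) (t := Finset.univ)
      (fun _ _ => Finset.mem_coe.2 (Finset.mem_univ _))]
    apply Finset.sum_le_sum
    intro k _
    have inj : ∀ p ∈ S.filter (fun p => p.1.2 = k), ∀ q ∈ S.filter (fun p => p.1.2 = k),
        p.1 = q.1 ∧ (p.2.2 = q.2.2 → p = q) := by
      rintro ⟨⟨i, k1⟩, ⟨r, j⟩⟩ hp ⟨⟨i', k1'⟩, ⟨r', j'⟩⟩ hq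
      simp only [hS, Finset.mem_filter, Set.mem_toFinset, Set.mem_setOf_eq] at hp hq
      obtain ⟨⟨-, -, a, b, -⟩, rfl⟩ := hp
      obtain ⟨⟨-, -, a', b', -⟩, rfl⟩ := hq
      have hi : i = i' := h3 k1' (a.trans a'.symm)
      subst hi
      refine ⟨rfl, ?_⟩
      intro hj
      simp only at hj
      subst hj
      have hr : r = r' := h3 j (b.trans b'.symm)
      rw [hr]
    apply le_min
    · rw [← Nat.card_Ioc e n]
      apply Finset.card_le_card_of_injOn (fun p => L p.1.1 p.2.2)
      · intro p hp
        simp only [hS, Finset.coe_filter, Set.mem_toFinset, Set.mem_setOf_eq] at hp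
        have := Finset.mem_Icc.1 (h1 p.1.1 p.2.2)
        simp only [Finset.coe_Ioc, Set.mem_Ioc]
        omega
      · intro p hp q hq hpq
        obtain ⟨x, y⟩ := inj p hp q hq
        apply y
        simp only [x] at hpq
        exact h2 _ hpq
    · rw [← Fin.card_Iio k]
      apply Finset.card_le_card_of_injOn (fun p => p.2.2)
      · intro p hp
        simp only [hS, Finset.coe_filter, Set.mem_toFinset, Set.mem_setOf_eq] at hp
        simp only [Finset.coe_Iio, Set.mem_Iio]
        rw [← hp.2]
        exact hp.1.2.1
      · intro p hp q hq hpq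
        exact (inj p hp q hq).2 hpq
  rw [Fin.sum_univ_eq_sum_range (fun k => min (n - e) k)] at key
  have := sum_min_aux (n - e) e
  rw [Nat.sub_add_cancel he'.2] at this
  rw [← Finset.sum_range_id, ← Finset.sum_range_id]
  omega
end

section
/- Let L be an n×n Latin square and e ∈ {1,…,n}. Let G[e] be the graph whose vertices are the n cells of L with entry e, where two such cells (i,k) and (r,j) with i<r and j<k are adjacent if and only if L(i,j) > e. Then G[e] contains an independent set of size at least n²/(n² − e(e−1)). -/
open Finset in
lemma row_surj {n : ℕ} (f : Fin n → ℕ) (hf : Function.Injective f)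
    (hm : ∀ j, f j ∈ Finset.Icc 1 n) (a : ℕ) (ha : a ∈ Finset.Icc 1 n) : ∃ j, f j = a := by
  have h : (univ : Finset (Fin n)).image f = Finset.Icc 1 n := by
    apply Finset.eq_of_subset_of_card_le
    · intro x hx
      simp only [Finset.mem_image, Finset.mem_univ, true_and] at hx
      obtain ⟨j, rfl⟩ := hx
      exact hm j
    · rw [Finset.card_image_of_injective _ hf]; simp
  rw [← h] at ha
  simpa using ha

open Finset in
lemma row_count {n : ℕ} (f : Fin n → ℕ) (hf : Function.Injective f)
    (hm : ∀ j, f j ∈ Finset.Icc 1 n) (e : ℕ) (he : e ∈ Finset.Icc 1 n) (i : Fin n)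
    (hi : f i = e) :
    e - 1 - (i : ℕ) ≤ #{r : Fin n | i < r ∧ f r < e} := by
  have h1 : e - 1 ≤ #{r : Fin n | f r < e} := by
    have hsub : Finset.Ico 1 e ⊆ ({r : Fin n | f r < e} : Finset (Fin n)).image f := by
      intro a ha
      rw [Finset.mem_Ico] at ha
      rw [Finset.mem_Icc] at he
      obtain ⟨j, hj⟩ := row_surj f hf hm a (by rw [Finset.mem_Icc]; omega)
      rw [Finset.mem_image]
      exact ⟨j, by simp [hj, ha.2], hj⟩
    have := (Finset.card_le_card hsub).trans Finset.card_image_le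
    simpa using this
  have h2 : ({r : Fin n | f r < e} : Finset (Fin n)) ⊆
      Finset.Iio i ∪ ({r : Fin n | i < r ∧ f r < e} : Finset (Fin n)) := by
    intro r hr
    simp only [Finset.mem_filter, Finset.mem_univ, true_and, Finset.mem_union,
      Finset.mem_Iio] at hr ⊢
    rcases lt_trichotomy r i with h | h | h
    · exact Or.inl h
    · subst h; omega
    · exact Or.inr ⟨h, hr⟩
  have h3 := (Finset.card_le_card h2).trans (Finset.card_union_le _ _)
  rw [Fin.card_Iio] at h3
  omega

lemma sum_aux (n e : ℕ) (he : 1 ≤ e) (hen : e ≤ n) :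
    e * (e - 1) ≤ 2 * ∑ i : Fin n, (e - 1 - (i : ℕ)) := by
  rw [Fin.sum_univ_eq_sum_range (fun i => e - 1 - i) n]
  have h1 : ∑ i ∈ Finset.range e, (e - 1 - i) ≤ ∑ i ∈ Finset.range n, (e - 1 - i) :=
    Finset.sum_le_sum_of_subset (Finset.range_mono hen)
  rw [Finset.sum_range_reflect (fun i => i) e] at h1
  have := Finset.sum_range_id_mul_two e
  omega

open Finset in
lemma turan_aux {n : ℕ} (G : SimpleGraph (Fin n)) [DecidableRel G.Adj] {r : ℕ}
    (cf : G.CliqueFree (r + 1)) : r * (2 * #G.edgeFinset) ≤ (r - 1) * n ^ 2 := by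
  have h1 := cf.card_edgeFinset_le
  simp only [Fintype.card_fin] at h1
  rw [← SimpleGraph.card_edgeFinset_turanGraph] at h1
  have h2 := SimpleGraph.mul_card_edgeFinset_turanGraph_le (n := n) (r := r)
  calc r * (2 * #G.edgeFinset) = 2 * r * #G.edgeFinset := by ring
    _ ≤ _ := Nat.mul_le_mul_left _ h1
    _ ≤ _ := h2

/-- the graph `G[e]` on the `n` cells of `L` with entry `e`, in which two
such cells `(i, k)` and `(r, j)` with `i < r` and `j < k` are adjacent iff `L i j > e`,
contains an independent set of size at least `n² / (n² - e(e-1))`. -/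
theorem entry_graph_independent_set {n : ℕ} (L : Fin n → Fin n → ℕ) (hL : IsLatin n L)
    (e : ℕ) (he : e ∈ Finset.Icc 1 n) :
    ∃ I : Set (Fin n × Fin n),
      (∀ p ∈ I, L p.1 p.2 = e) ∧
      (∀ p ∈ I, ∀ q ∈ I, p ≠ q →
        ¬ ((p.1 < q.1 ∧ q.2 < p.2 ∧ e < L p.1 q.2) ∨
           (q.1 < p.1 ∧ p.2 < q.2 ∧ e < L q.1 p.2))) ∧
      (n : ℝ) ^ 2 / ((n : ℝ) ^ 2 - (e : ℝ) * ((e : ℝ) - 1)) ≤ (I.ncard : ℝ) := by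
  classical
  obtain ⟨hm, hrow, hcol⟩ := hL
  have he' := Finset.mem_Icc.mp he
  choose σ hσ using fun i => row_surj (L i) (hrow i) (hm i) e he
  have hσi : Function.Injective σ := by
    intro a b hab
    apply hcol (σ a)
    change L a (σ a) = L b (σ a)
    rw [hσ a, hab, hσ b]
  let R : Fin n → Fin n → Prop := fun i r => i < r ∧ L i (σ r) < e
  let G : SimpleGraph (Fin n) :=
    { Adj := fun i r => R i r ∨ R r i
      symm := ⟨fun _ _ h => h.symm⟩
      loopless := ⟨fun i h => by rcases h with h | h <;> exact lt_irrefl _ h.1⟩ }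
  obtain ⟨s, hs⟩ := G.exists_isNClique_cliqueNum
  have cf : G.CliqueFree (G.cliqueNum + 1) := by
    intro t ht
    have := ht.isClique.card_le_cliqueNum
    rw [ht.card_eq] at this
    omega
  have hT := turan_aux G cf
  -- edge count
  have hE : e * (e - 1) ≤ 2 * G.edgeFinset.card := by
    have hsum : ∑ i : Fin n, (e - 1 - (i : ℕ)) ≤
        ((Finset.univ : Finset (Fin n × Fin n)).filter fun p => R p.1 p.2).card := by
      rw [Finset.card_filter, Fintype.sum_prod_type]
      apply Finset.sum_le_sum
      intro i _
      rw [← Finset.card_filter]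
      exact row_count (fun r => L i (σ r)) ((hrow i).comp hσi) (fun j => hm i _) e he i (hσ i)
    refine (sum_aux n e he'.1 he'.2).trans ?_
    refine (Nat.mul_le_mul_left 2 hsum).trans ?_
    rw [G.two_mul_card_edgeFinset]
    set A := (Finset.univ : Finset (Fin n × Fin n)).filter fun p => R p.1 p.2 with hA
    have hc : (A.image Prod.swap).card = A.card :=
      Finset.card_image_of_injective _ Prod.swap_injective
    have hd : Disjoint A (A.image Prod.swap) := by
      rw [Finset.disjoint_left]
      rintro ⟨a, b⟩ h1 h2
      rw [Finset.mem_image] at h2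
      obtain ⟨⟨c, d⟩, h3, h4⟩ := h2
      simp only [Prod.swap_prod_mk, Prod.mk.injEq] at h4
      obtain ⟨rfl, rfl⟩ := h4
      have h5 := (Finset.mem_filter.mp h1).2.1
      have h6 := (Finset.mem_filter.mp h3).2.1
      exact lt_asymm h5 h6
    rw [two_mul]
    nth_rewrite 2 [← hc]
    rw [← Finset.card_union_of_disjoint hd]
    apply Finset.card_le_card
    rintro ⟨a, b⟩ h
    rw [Finset.mem_union, Finset.mem_image] at h
    simp only [Finset.mem_filter, Finset.mem_univ, true_and]
    rcases h with h | ⟨⟨c, d⟩, h3, h4⟩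
    · exact Or.inl (Finset.mem_filter.mp h).2
    · simp only [Prod.swap_prod_mk, Prod.mk.injEq] at h4
      obtain ⟨rfl, rfl⟩ := h4
      exact Or.inr (Finset.mem_filter.mp h3).2
  refine ⟨((s.image fun i => (i, σ i) : Finset (Fin n × Fin n)) : Set (Fin n × Fin n)), ?_, ?_, ?_⟩
  · intro p hp
    simp only [Finset.coe_image, Set.mem_image] at hp
    obtain ⟨i, _, rfl⟩ := hp
    exact hσ i
  · intro p hp q hq hpq
    simp only [Finset.coe_image, Set.mem_image] at hp hq
    obtain ⟨i, hi, rfl⟩ := hp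
    obtain ⟨r, hr, rfl⟩ := hq
    have hne : i ≠ r := fun h => hpq (by rw [h])
    have hadj : R i r ∨ R r i := hs.isClique hi hr hne
    simp only
    rintro (⟨h1, _, h3⟩ | ⟨h1, _, h3⟩) <;> rcases hadj with ⟨h4, h5⟩ | ⟨h4, h5⟩
    · omega
    · exact lt_asymm h1 h4
    · exact lt_asymm h1 h4
    · omega
  · rw [Set.ncard_coe_finset, Finset.card_image_of_injective _
      (fun a b h => (Prod.mk.injEq _ _ _ _ ▸ h : a = b ∧ _).1), hs.card_eq]
    have hpos : 1 ≤ G.cliqueNum := by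
      have hc : G.IsClique (({⟨0, by omega⟩} : Finset (Fin n)) : Set (Fin n)) := by simp
      simpa using hc.card_le_cliqueNum
    have h := (Nat.mul_le_mul_left G.cliqueNum hE).trans hT
    have h' : (G.cliqueNum : ℝ) * (e * (e - 1)) ≤ (G.cliqueNum - 1) * (n : ℝ) ^ 2 := by
      have := (Nat.cast_le (α := ℝ)).mpr h
      push_cast [Nat.cast_sub hpos, Nat.cast_sub he'.1] at this
      exact this
    have h1 : (1 : ℝ) ≤ e := by exact_mod_cast he'.1
    have h2 : (e : ℝ) ≤ n := by exact_mod_cast he'.2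
    rw [div_le_iff₀ (by nlinarith)]
    linarith
end

section
/- Let L be an n×n Latin square and let E(L) be the graph on the n² cells of L in which two cells (i,k) and (r,j) with L(i,k)=L(r,j), i<r and j<k are adjacent if and only if L(i,j) > L(i,k). Then E(L) contains an independent set of size at least n · Σ_{j=0}^{n−1} 1/(2j+1). -/
theorem exists_indep_of_outdeg {α : Type*} [DecidableEq α] (R : α → α → Prop) [DecidableRel R]
    (d : ℕ) : ∀ (m : ℕ) (S : Finset α), S.card ≤ m →
    (∀ p ∈ S, (S.filter fun q => R p q).card ≤ d) →
    ∃ I ⊆ S, (∀ p ∈ I, ∀ q ∈ I, p ≠ q → ¬ R p q) ∧ S.card ≤ (2 * d + 1) * I.card := by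
  intro m
  induction m with
  | zero =>
    intro S hS _
    exact ⟨∅, by simp, by simp, by simpa using hS⟩
  | succ m ih =>
    intro S hS hd
    rcases S.eq_empty_or_nonempty with rfl | hne
    · exact ⟨∅, by simp, by simp, by simp⟩
    have hx : ∃ x ∈ S, (S.filter fun q => R q x).card ≤ d := by
      by_contra! hcon
      have h1 := Finset.sum_card_bipartiteAbove_eq_sum_card_bipartiteBelow (s := S) (t := S) R
      simp only [Finset.bipartiteAbove, Finset.bipartiteBelow] at h1
      have h2 := Finset.sum_le_sum hd
      have h3 := Finset.sum_lt_sum_of_nonempty hne hcon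
      omega
    obtain ⟨x, hxS, hx⟩ := hx
    set A := S.filter fun q => R x q with hA
    set B := S.filter fun q => R q x with hB
    set N := insert x (A ∪ B) with hN
    have hNc : N.card ≤ 2 * d + 1 := by
      have h1 := Finset.card_insert_le x (A ∪ B)
      have h2 := Finset.card_union_le A B
      have h3 : A.card ≤ d := hd x hxS
      have h4 : N.card ≤ (A ∪ B).card + 1 := h1
      omega
    have hxT : x ∉ S \ N := by simp [hN]
    have hlt : (S \ N).card < S.card :=
      Finset.card_lt_card ⟨Finset.sdiff_subset, fun h => hxT (h hxS)⟩
    have hle : S.card ≤ (S \ N).card + N.card := by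
      have := Finset.le_card_sdiff N S
      omega
    obtain ⟨I, hIS, hI, hc⟩ := ih (S \ N) (by omega) (fun p hp =>
      (Finset.card_le_card (Finset.filter_subset_filter _ Finset.sdiff_subset)).trans
        (hd p (Finset.sdiff_subset hp)))
    have hxI : x ∉ I := fun h => hxT (hIS h)
    have hno : ∀ q ∈ I, ¬ R x q ∧ ¬ R q x := by
      intro q hq
      have := hIS hq
      simp only [hN, hA, hB, Finset.mem_sdiff, Finset.mem_insert, Finset.mem_union,
        Finset.mem_filter] at this
      tauto
    refine ⟨insert x I, ?_, ?_, ?_⟩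
    · exact Finset.insert_subset hxS (hIS.trans Finset.sdiff_subset)
    · intro p hp q hq hpq
      rcases Finset.mem_insert.1 hp with rfl | hp1
      · rcases Finset.mem_insert.1 hq with rfl | hq
        · exact absurd rfl hpq
        · exact (hno q hq).1
      · rcases Finset.mem_insert.1 hq with rfl | hq
        · exact (hno p hp1).2
        · exact hI p hp1 q hq hpq
    · rw [Finset.card_insert_of_notMem hxI]
      nlinarith

/-- the graph `E(L)` on the `n²` cells of `L`, in which two cells `(i, k)`
and `(r, j)` with the same entry, `i < r` and `j < k` are adjacent iff `L i j > L i k`,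
contains an independent set of size at least `n · Σ_{j=0}^{n-1} 1/(2j+1)`. -/
theorem entryGraph_independent_set {n : ℕ} (L : Fin n → Fin n → ℕ) (hL : IsLatin n L) :
    ∃ I : Set (Fin n × Fin n),
      (∀ p ∈ I, ∀ q ∈ I, p ≠ q →
        ¬ (L p.1 p.2 = L q.1 q.2 ∧
          ((p.1 < q.1 ∧ q.2 < p.2 ∧ L p.1 p.2 < L p.1 q.2) ∨
           (q.1 < p.1 ∧ p.2 < q.2 ∧ L q.1 q.2 < L q.1 p.2)))) ∧
      (n : ℝ) * ∑ j ∈ Finset.range n, (1 : ℝ) / (2 * (j : ℝ) + 1) ≤ (I.ncard : ℝ) := by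
  classical
  obtain ⟨hr, hrow, hcol⟩ := hL
  let R : Fin n × Fin n → Fin n × Fin n → Prop := fun p q =>
    p.1 < q.1 ∧ q.2 < p.2 ∧ L p.1 p.2 < L p.1 q.2
  let S : ℕ → Finset (Fin n × Fin n) := fun v => Finset.univ.filter fun p => L p.1 p.2 = v
  have hS : ∀ v, ∀ p, p ∈ S v ↔ L p.1 p.2 = v := fun v p => by simp [S]
  have hd : ∀ v, ∀ p ∈ S v, ((S v).filter fun q => R p q).card ≤ n - v := by
    intro v p hp
    rw [← Nat.card_Ioc]
    apply Finset.card_le_card_of_injOn (fun q => L p.1 q.2)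
    · intro q hq
      have hq' := Finset.mem_filter.1 (Finset.mem_coe.1 hq)
      have h1 := hq'.2.2.2
      have h2 := (hS v p).1 hp
      have h3 := Finset.mem_Icc.1 (hr p.1 q.2)
      simp only [Finset.coe_Ioc, Set.mem_Ioc]
      omega
    · intro q hq q' hq' h
      have hq1 := (hS v q).1 (Finset.mem_filter.1 (Finset.mem_coe.1 hq)).1
      have hq2 := (hS v q').1 (Finset.mem_filter.1 (Finset.mem_coe.1 hq')).1
      have h2 : q.2 = q'.2 := hrow p.1 h
      have h1 : q.1 = q'.1 := by
        apply hcol q.2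
        show L q.1 q.2 = L q'.1 q.2
        rw [hq1, h2, hq2]
      exact Prod.ext h1 h2
  have hcard : ∀ v ∈ Finset.Icc 1 n, n ≤ (S v).card := by
    intro v hv
    have hsurj : ∀ i, ∃ j, L i j = v := by
      intro i
      have himg : Finset.univ.image (L i) = Finset.Icc 1 n := by
        apply Finset.eq_of_subset_of_card_le
        · intro x hx
          obtain ⟨j, -, rfl⟩ := Finset.mem_image.1 hx
          exact hr i j
        · rw [Finset.card_image_of_injective _ (hrow i)]; simp
      rw [← himg] at hv
      obtain ⟨j, -, h⟩ := Finset.mem_image.1 hv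
      exact ⟨j, h⟩
    choose c hc using hsurj
    have := Finset.card_le_card_of_injOn (s := (Finset.univ : Finset (Fin n))) (t := S v)
      (fun i => (i, c i)) (fun i _ => (hS v _).2 (hc i))
      (fun i _ j _ h => (Prod.ext_iff.1 h).1)
    simpa using this
  have hex := fun v => exists_indep_of_outdeg R (n - v) _ (S v) le_rfl (hd v)
  choose J hJS hJ hJc using hex
  refine ⟨((Finset.Icc 1 n).biUnion J : Finset (Fin n × Fin n)), ?_, ?_⟩
  · intro p hp q hq hpq ⟨he, h⟩
    obtain ⟨v, -, hv⟩ := Finset.mem_biUnion.1 (Finset.mem_coe.1 hp)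
    obtain ⟨w, -, hw⟩ := Finset.mem_biUnion.1 (Finset.mem_coe.1 hq)
    have h1 := (hS v p).1 (hJS v hv)
    have h2 := (hS w q).1 (hJS w hw)
    obtain rfl : v = w := by omega
    rcases h with h | h
    · exact hJ v p hv q hw hpq h
    · exact hJ v q hw p hv hpq.symm h
  · rw [Set.ncard_coe_finset, Finset.card_biUnion]
    · have hre : ∑ j ∈ Finset.range n, (1 : ℝ) / (2 * (j : ℝ) + 1)
          = ∑ v ∈ Finset.Icc 1 n, (1 : ℝ) / (2 * ((n - v : ℕ) : ℝ) + 1) := by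
        apply Finset.sum_bij' (fun j _ => n - j) (fun v _ => n - v)
        · intro j hj; simp at hj ⊢; omega
        · intro j hj; simp at hj ⊢; omega
        · intro j hj; simp at hj ⊢; omega
        · intro j hj; simp at hj ⊢; omega
        · intro j hj
          have : n - (n - j) = j := by simp at hj; omega
          rw [this]
      rw [hre, Finset.mul_sum]
      push_cast
      apply Finset.sum_le_sum
      intro v hv
      have h1 := (hcard v hv).trans (hJc v)
      have h2 : (n : ℝ) ≤ (2 * ((n - v : ℕ) : ℝ) + 1) * ((J v).card : ℝ) := by exact_mod_cast h1
      rw [mul_one_div, div_le_iff₀ (by positivity)]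
      linarith
    · intro v _ w _ hvw
      refine Finset.disjoint_left.2 ?_
      intro p hp hp'
      exact hvw (((hS v p).1 (hJS v hp)).symm.trans ((hS w p).1 (hJS w hp')))
end

section
/- For every integer k ≥ 0 and n = 2^k, there exists an n×n Latin square with no descents; equivalently, there exists an n×n Latin square for which the empty set is a greedy defining set (so the minimum greedy defining number over all n×n Latin squares is 0 when n is a power of two). -/
/-- for every `k ≥ 0` and `n = 2^k`, there is an `n × n` Latin square with
no descents — equivalently, one for which the empty set is a greedy defining set (so the
minimum greedy defining number over `n × n` Latin squares is `0` when `n` is a power of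
two). -/
theorem exists_latin_square_without_descent_of_pow_two (k : ℕ) :
    ∃ L : Fin (2 ^ k) → Fin (2 ^ k) → ℕ, IsLatin (2 ^ k) L ∧
      (∀ T : Set (Fin (2 ^ k) × Fin (2 ^ k)), ¬ IsLatinDescent L T) ∧
      IsLatinGDS L (∅ : Set (Fin (2 ^ k) × Fin (2 ^ k))) := by
  refine ⟨fun i j => (i.val ^^^ j.val) + 1, ⟨?_, ?_, ?_⟩, ?_, ?_⟩
  · intro i j
    have := Nat.xor_lt_two_pow i.isLt j.isLt
    simp only [Finset.mem_Icc]
    omega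
  · intro i a b h
    have h' : i.val ^^^ a.val = i.val ^^^ b.val := Nat.succ.inj h
    exact Fin.ext (Nat.xor_right_injective h')
  · intro j a b h
    have h' : a.val ^^^ j.val = b.val ^^^ j.val := Nat.succ.inj h
    exact Fin.ext (Nat.xor_left_injective h')
  · rintro T ⟨i, r, j, l, hir, hjl, he, hlt, -⟩
    have he' : r.val ^^^ j.val = i.val ^^^ l.val := Nat.succ.inj he
    have hlt' : i.val ^^^ l.val < i.val ^^^ j.val := Nat.lt_of_succ_lt_succ hlt
    have hir' : i.val < r.val := hir
    have hjl' : j.val < l.val := hjl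
    rcases Nat.lt_xor_cases hlt' with h | h
    · rw [← he', Nat.xor_xor_cancel_right] at h
      omega
    · rw [Nat.xor_comm i.val l.val, Nat.xor_xor_cancel_right] at h
      omega
  · rintro ⟨i, j⟩ -
    symm
    apply IsLeast.csInf_eq
    refine ⟨⟨Nat.succ_pos _, ?_⟩, ?_⟩
    · rintro ⟨a, b⟩ hne hrc - h
      have h' : a.val ^^^ b.val = i.val ^^^ j.val := Nat.succ.inj h
      apply hne
      rcases hrc with h1 | h1
      · have h1' : a = i := h1
        subst h1'
        rw [Fin.ext (Nat.xor_right_injective h')]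
      · have h1' : b = j := h1
        subst h1'
        rw [Fin.ext (Nat.xor_left_injective h')]
    · rintro c ⟨hc, hq⟩
      by_contra hlt
      obtain ⟨d, rfl⟩ : ∃ d, c = d + 1 := ⟨c - 1, by omega⟩
      have hd : d < i.val ^^^ j.val := by
        simp only [not_le] at hlt
        omega
      rcases Nat.lt_xor_cases hd with h | h
      · have hlt2 : (⟨d ^^^ j.val, h.trans i.isLt⟩ : Fin (2 ^ k)) < i := h
        refine hq (⟨d ^^^ j.val, h.trans i.isLt⟩, j) ?_ (Or.inr rfl) (Or.inr (Or.inl hlt2)) ?_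
        · intro e
          exact hlt2.ne (congrArg Prod.fst e)
        · simp [Nat.xor_xor_cancel_right]
      · have hlt2 : (⟨d ^^^ i.val, h.trans j.isLt⟩ : Fin (2 ^ k)) < j := h
        refine hq (i, ⟨d ^^^ i.val, h.trans j.isLt⟩) ?_ (Or.inl rfl)
          (Or.inr (Or.inr ⟨rfl, hlt2⟩)) ?_
        · intro e
          exact hlt2.ne (congrArg Prod.snd e)
        · show (i.val ^^^ (d ^^^ i.val)) + 1 = d + 1
          rw [Nat.xor_comm, Nat.xor_xor_cancel_right]
end
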